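/- arXiv:1911.04758 — 9 statements merged into one kernel-verified Lean document; each statement's English description precedes it below -/
import Mathlib

section
/- Let H be a real Hilbert space, A : H → Set H a maximally monotone operator, and B : H → H monotone and (1/β)-Lipschitz continuous for some β > 0, with Zer(A + B) nonempty. Suppose x : (0, ∞) → H is such that for every ε > 0 one has −B(x(ε)) − ε·x(ε) ∈ A(x(ε)) (i.e. x(ε) is the unique zero of A + B + ε·Id). Then x(ε) converges strongly, as ε → 0⁺, to the unique element x* of Zer(A + B) of minimal norm, i.e. x* = P_{Zer(A+B)} 0. -/
open Filter MeasureTheory Set Topology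
open scoped RealInnerProductSpace

variable {H : Type*} [NormedAddCommGroup H] [InnerProductSpace ℝ H] [CompleteSpace H]

/-- A set-valued operator is monotone. -/
def MonotoneSV (A : H → Set H) : Prop :=
  ∀ x y u v : H, u ∈ A x → v ∈ A y → 0 ≤ ⟪u - v, x - y⟫

/-- A set-valued operator is maximally monotone. -/
def MaximallyMonotone (A : H → Set H) : Prop :=
  MonotoneSV A ∧ ∀ x u : H, (∀ y v : H, v ∈ A y → 0 ≤ ⟪u - v, x - y⟫) → u ∈ A x

theorem stmt0 (A : H → Set H) (B : H → H) (β : ℝ) (hβ : 0 < β)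
    (hA : MaximallyMonotone A)
    (hBmono : ∀ x y : H, 0 ≤ ⟪B x - B y, x - y⟫)
    (hBlip : ∀ x y : H, ‖B x - B y‖ ≤ (1 / β) * ‖x - y‖)
    (hZer : {z : H | -B z ∈ A z}.Nonempty)
    (x : ℝ → H)
    (hx : ∀ ε : ℝ, 0 < ε → -B (x ε) - ε • x ε ∈ A (x ε)) :
    ∃ xstar : H, xstar ∈ {z : H | -B z ∈ A z} ∧
      (∀ y ∈ {z : H | -B z ∈ A z}, ‖xstar‖ ≤ ‖y‖) ∧
      Tendsto x (𝓝[>] (0 : ℝ)) (𝓝 xstar) := by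
  have hmono : ∀ p q u v : H, -B p - u ∈ A p → -B q - v ∈ A q → ⟪u - v, p - q⟫ ≤ 0 := by
    intro p q u v hp hq
    have h1 := hA.1 _ _ _ _ hp hq
    have h2 := hBmono p q
    have h3 : (-B p - u) - (-B q - v) = -(B p - B q) - (u - v) := by abel
    rw [h3, inner_sub_left, inner_neg_left] at h1
    linarith
  have hbound : ∀ z : H, -B z ∈ A z → ∀ ε : ℝ, 0 < ε → ‖x ε‖ ≤ ‖z‖ := by
    intro z hz ε hε
    have h := hmono (x ε) z (ε • x ε) 0 (hx ε hε) (by simpa using hz)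
    rw [sub_zero, real_inner_smul_left, inner_sub_right, real_inner_self_eq_norm_sq] at h
    have h1 : ‖x ε‖ ^ 2 - ⟪x ε, z⟫ ≤ 0 := by
      by_contra hc
      push Not at hc
      have := mul_pos hε hc
      linarith
    have h2 := real_inner_le_norm (x ε) z
    by_contra hc
    push Not at hc
    nlinarith [norm_nonneg z, norm_nonneg (x ε)]
  have hkey : ∀ δ ε : ℝ, 0 < δ → δ < ε → ‖x δ - x ε‖ ^ 2 ≤ ‖x δ‖ ^ 2 - ‖x ε‖ ^ 2 := by
    intro δ ε hδ hlt
    have h := hmono (x ε) (x δ) (ε • x ε) (δ • x δ) (hx ε (hδ.trans hlt)) (hx δ hδ)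
    have e1 : ε • x ε - δ • x δ = (ε - δ) • x ε + δ • (x ε - x δ) := by
      rw [sub_smul, smul_sub]; abel
    rw [e1, inner_add_left, real_inner_smul_left, real_inner_smul_left,
      real_inner_self_eq_norm_sq] at h
    have h1 : ⟪x ε, x ε - x δ⟫ ≤ 0 := by
      by_contra hc
      push Not at hc
      have := mul_pos (sub_pos.2 hlt) hc
      have := mul_nonneg hδ.le (sq_nonneg ‖x ε - x δ‖)
      linarith
    rw [inner_sub_right, real_inner_self_eq_norm_sq] at h1
    rw [norm_sub_sq_real, real_inner_comm]
    linarith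
  obtain ⟨z0, hz0⟩ := hZer
  have hcau : Cauchy (map x (𝓝[>] (0 : ℝ))) := by
    rw [Metric.cauchy_iff]
    refine ⟨inferInstance, fun η hη => ?_⟩
    set S : Set ℝ := (fun ε => ‖x ε‖ ^ 2) '' Ioi 0 with hS
    have hne : S.Nonempty := ⟨_, 1, by simp, rfl⟩
    have hbdd : BddAbove S := by
      refine ⟨‖z0‖ ^ 2, ?_⟩
      rintro _ ⟨ε, hε, rfl⟩
      exact pow_le_pow_left₀ (norm_nonneg _) (hbound z0 hz0 ε hε) 2
    have hη2 : 0 < (η / 2) ^ 2 := by positivity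
    obtain ⟨_, ⟨ε, hε, rfl⟩, hlt⟩ := exists_lt_of_lt_csSup hne (sub_lt_self (sSup S) hη2)
    refine ⟨Metric.ball (x ε) (η / 2), ?_, ?_⟩
    · rw [mem_map]
      filter_upwards [Ioo_mem_nhdsGT (show (0 : ℝ) < ε from hε)] with δ hδ
      have h1 := hkey δ ε hδ.1 hδ.2
      have h2 : ‖x δ‖ ^ 2 ≤ sSup S := le_csSup hbdd ⟨δ, hδ.1, rfl⟩
      simp only [mem_preimage, Metric.mem_ball, dist_eq_norm]
      refine lt_of_pow_lt_pow_left₀ 2 (by positivity) ?_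
      simp only at hlt
      linarith
    · intro a ha b hb
      have := dist_triangle_right a b (x ε)
      simp only [Metric.mem_ball] at ha hb
      linarith
  obtain ⟨xs, hxs⟩ := CompleteSpace.complete hcau
  have hT : Tendsto x (𝓝[>] (0 : ℝ)) (𝓝 xs) := hxs
  refine ⟨xs, ?_, ?_, hT⟩
  · apply hA.2
    intro y v hv
    have hBc : Continuous B := by
      have : LipschitzWith (Real.toNNReal (1 / β)) B := by
        apply LipschitzWith.of_dist_le_mul
        intro a b
        rw [dist_eq_norm, dist_eq_norm, Real.coe_toNNReal _ (by positivity)]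
        exact hBlip a b
      exact this.continuous
    have hBT : Tendsto (fun ε => B (x ε)) (𝓝[>] (0 : ℝ)) (𝓝 (B xs)) :=
      (hBc.tendsto xs).comp hT
    have hid : Tendsto (fun ε : ℝ => ε) (𝓝[>] (0 : ℝ)) (𝓝 0) :=
      tendsto_id.mono_left nhdsWithin_le_nhds
    have hlim := (((hBT.neg.sub (hid.smul hT)).sub_const v).inner (𝕜 := ℝ) (hT.sub_const y))
    rw [zero_smul, sub_zero] at hlim
    refine ge_of_tendsto hlim ?_
    filter_upwards [self_mem_nhdsWithin] with ε hε
    exact hA.1 _ _ _ _ (hx ε hε) hv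
  · intro y hy
    refine le_of_tendsto hT.norm ?_
    filter_upwards [self_mem_nhdsWithin] with ε hε
    exact hbound y hy ε hε
end

section
/- Let H be a real Hilbert space, A : H → Set H a monotone set-valued operator and B : H → H a monotone operator. Let ε₁, ε₂ > 0 and x₁, x₂ ∈ H satisfy −B x₁ − ε₁·x₁ ∈ A x₁ and −B x₂ − ε₂·x₂ ∈ A x₂. Then ‖x₁ − x₂‖ ≤ (‖x₁‖ / ε₂) · |ε₁ − ε₂|. -/
open Filter MeasureTheory Set Topology
open scoped RealInnerProductSpace

variable {H : Type*} [NormedAddCommGroup H] [InnerProductSpace ℝ H] [CompleteSpace H]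

theorem stmt1 (A : H → Set H) (B : H → H)
    (hA : MonotoneSV A)
    (hBmono : ∀ x y : H, 0 ≤ ⟪B x - B y, x - y⟫)
    (ε₁ ε₂ : ℝ) (hε₁ : 0 < ε₁) (hε₂ : 0 < ε₂)
    (x₁ x₂ : H)
    (h1 : -B x₁ - ε₁ • x₁ ∈ A x₁)
    (h2 : -B x₂ - ε₂ • x₂ ∈ A x₂) :
    ‖x₁ - x₂‖ ≤ (‖x₁‖ / ε₂) * |ε₁ - ε₂| := by
  have ha := hA _ _ _ _ h1 h2
  have hb := hBmono x₁ x₂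
  have hsum : (-B x₁ - ε₁ • x₁ - (-B x₂ - ε₂ • x₂)) + (B x₁ - B x₂)
      = -((ε₁ - ε₂) • x₁) - ε₂ • (x₁ - x₂) := by
    module
  have h := add_nonneg ha hb
  rw [← inner_add_left, hsum, inner_sub_left, inner_neg_left, real_inner_smul_left,
    real_inner_smul_left, real_inner_self_eq_norm_sq] at h
  have hcs : -((ε₁ - ε₂) * ⟪x₁, x₁ - x₂⟫) ≤ |ε₁ - ε₂| * (‖x₁‖ * ‖x₁ - x₂‖) := by
    refine (neg_le_abs _).trans ?_
    rw [abs_mul]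
    exact mul_le_mul_of_nonneg_left (abs_real_inner_le_norm _ _) (abs_nonneg _)
  rw [div_mul_eq_mul_div, le_div_iff₀ hε₂]
  rcases (norm_nonneg (x₁ - x₂)).eq_or_lt with h0 | h0
  · rw [← h0, zero_mul]
    positivity
  · refine le_of_mul_le_mul_right ?_ h0
    nlinarith
end

section
/- Let H be a real Hilbert space, T : H → H nonexpansive with Fix T nonempty, λ : [0, ∞) → (0, 1] and ε : [0, ∞) → [0, ∞) Lebesgue measurable with ε locally integrable, and let x : [0, ∞) → H be the strong global solution of ẋ(t) = λ(t)·(T(x(t)) − x(t)) − ε(t)·x(t), x(0) = x₀ ∈ H. Assume: (i) ∫₀^∞ ε(t) dt = ∞; (ii) ∫₀^∞ λ(t) dt = ∞; (iii) ε and λ are locally absolutely continuous and ε(t)/λ(t) → 0 as t → ∞; (iv) ∫₀^∞ |(d/dt)(ε(t)/λ(t))| dt < ∞. Then x(t) converges strongly, as t → ∞, to P_{Fix T} 0, the minimum-norm fixed point of T. -/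
open Filter MeasureTheory Set Topology
open scoped RealInnerProductSpace

variable {H : Type*} [NormedAddCommGroup H] [InnerProductSpace ℝ H] [CompleteSpace H]

/-- `x` is a strong global solution of `ẋ(t) = f(t, x(t))`, `x(0) = x₀`, on `[0,∞)`. -/
def IsStrongGlobalSolution (f : ℝ → H → H) (x₀ : H) (x : ℝ → H) : Prop :=
  ContinuousOn x (Set.Ici (0 : ℝ)) ∧
  (∀ b : ℝ, IntervalIntegrable (fun s => f s (x s)) volume 0 b) ∧
  ∀ t : ℝ, 0 ≤ t → x t = x₀ + ∫ s in (0:ℝ)..t, f s (x s)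

theorem aux_mono (T : H → H) (hT : ∀ x y : H, ‖T x - T y‖ ≤ ‖x - y‖) (x y : H) :
    0 ≤ ⟪(x - T x) - (y - T y), x - y⟫ := by
  have h1 : (x - T x) - (y - T y) = (x - y) - (T x - T y) := by abel
  rw [h1, inner_sub_left, real_inner_self_eq_norm_sq]
  have h2 := real_inner_le_norm (T x - T y) (x - y)
  have h3 := hT x y
  nlinarith [norm_nonneg (x - y)]

theorem aux_exists (T : H → H) (hT : ∀ x y : H, ‖T x - T y‖ ≤ ‖x - y‖) (s : ℝ) (hs : 0 < s) :
    ∃ y : H, y - T y = -(s • y) := by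
  have hc : ContractingWith (Real.toNNReal (1 / (1 + s))) (fun y : H => (1 / (1 + s)) • T y) := by
    constructor
    · rw [Real.toNNReal_lt_one, div_lt_one (by linarith)]
      linarith
    · apply LipschitzWith.of_dist_le_mul
      intro a b
      rw [Real.coe_toNNReal _ (by positivity), dist_eq_norm, dist_eq_norm, ← smul_sub, norm_smul,
        Real.norm_of_nonneg (by positivity)]
      exact mul_le_mul_of_nonneg_left (hT a b) (by positivity)
  refine ⟨hc.fixedPoint, ?_⟩
  have h := hc.fixedPoint_isFixedPt
  set y := hc.fixedPoint
  have h' : (1 / (1 + s)) • T y = y := h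
  have h2 : T y = (1 + s) • y := by
    conv_rhs => rw [← h']
    rw [smul_smul, mul_one_div_cancel (by linarith), one_smul]
  rw [h2, add_smul, one_smul]
  abel

theorem aux_tik (T : H → H) (hT : ∀ x y : H, ‖T x - T y‖ ≤ ‖x - y‖)
    (hFix : ∃ z : H, T z = z) :
    ∃ (p : H) (K : ℝ), T p = p ∧ (∀ q : H, T q = q → ‖p‖ ≤ ‖q‖) ∧
      ∀ η > 0, ∃ (s : ℝ) (y : H), 0 < s ∧ y - T y = -(s • y) ∧ ‖y‖ ≤ K ∧ ‖y - p‖ < η := by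
  obtain ⟨z, hz⟩ := hFix
  let σ : ℕ → ℝ := fun n => 1 / ((n : ℝ) + 1)
  have hσ : ∀ n, 0 < σ n := fun n => by simp only [σ]; positivity
  have hσa : ∀ m n, m ≤ n → σ n ≤ σ m := fun m n h => by
    simp only [σ]
    have : (m : ℝ) ≤ n := by exact_mod_cast h
    gcongr
  have hσ0 : Tendsto σ atTop (𝓝 0) := tendsto_one_div_add_atTop_nhds_zero_nat
  choose y hy using fun n => aux_exists T hT (σ n) (hσ n)
  have hb : ∀ q, T q = q → ∀ n, ‖y n‖ ≤ ‖q‖ := by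
    intro q hq n
    have h := aux_mono T hT (y n) q
    rw [hq, sub_self, sub_zero, hy n, inner_neg_left, real_inner_smul_left, inner_sub_right,
      real_inner_self_eq_norm_sq] at h
    have h2 := real_inner_le_norm (y n) q
    have h3 : ‖y n‖ ^ 2 - ⟪y n, q⟫ ≤ 0 := by
      by_contra hc
      push Not at hc
      have := mul_pos (hσ n) hc
      linarith
    by_contra hc
    push Not at hc
    nlinarith [norm_nonneg q, norm_nonneg (y n)]
  have hm : ∀ m n, m ≤ n → ‖y n - y m‖ ^ 2 ≤ ‖y n‖ ^ 2 - ‖y m‖ ^ 2 := by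
    intro m n hmn
    have h := aux_mono T hT (y m) (y n)
    rw [hy m, hy n] at h
    have e : ‖y n - y m‖ ^ 2 = ‖y n‖ ^ 2 - 2 * ⟪y n, y m⟫ + ‖y m‖ ^ 2 := norm_sub_sq_real _ _
    simp only [inner_sub_left, inner_sub_right, inner_neg_left, real_inner_smul_left,
      real_inner_self_eq_norm_sq, real_inner_comm (y n) (y m)] at h
    have h1 := hσa m n hmn
    have h2 := hσ n
    have h3 := hσ m
    rcases eq_or_lt_of_le h1 with h4 | h4
    · rw [h4] at h
      have : ‖y n - y m‖ ^ 2 ≤ 0 := by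
        rw [e]
        by_contra hc
        push Not at hc
        have := mul_pos h3 hc
        linarith
      have h0 : y n - y m = 0 := by
        have : ‖y n - y m‖ = 0 := by nlinarith [sq_nonneg ‖y n - y m‖]
        exact norm_eq_zero.1 this
      rw [sub_eq_zero] at h0
      rw [h0]; simp
    · have h5 : 0 ≤ ⟪y n, y m⟫ - ‖y m‖ ^ 2 := by
        by_contra hc
        push Not at hc
        have g1 := mul_neg_of_pos_of_neg (sub_pos.2 h4) hc
        have g2 := mul_nonneg h2.le (sq_nonneg ‖y n - y m‖)
        rw [e] at g2
        linarith
      rw [e]; linarith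
  have hmono : Monotone (fun n => ‖y n‖ ^ 2) := by
    intro m n h
    have := hm m n h
    have := sq_nonneg ‖y n - y m‖
    simp only; linarith
  have hbd : BddAbove (Set.range (fun n => ‖y n‖ ^ 2)) := by
    refine ⟨‖z‖ ^ 2, ?_⟩
    rintro _ ⟨n, rfl⟩
    exact pow_le_pow_left₀ (norm_nonneg _) (hb z hz n) 2
  have hcv := tendsto_atTop_ciSup hmono hbd
  have hcau : CauchySeq y := by
    rw [Metric.cauchySeq_iff']
    intro η hη
    obtain ⟨N, hN⟩ := Metric.cauchySeq_iff'.1 hcv.cauchySeq (η ^ 2) (by positivity)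
    refine ⟨N, fun n hn => ?_⟩
    have h1 := hN n hn
    rw [Real.dist_eq] at h1
    have h2 := hm N n hn
    rw [dist_eq_norm]
    exact lt_of_pow_lt_pow_left₀ 2 hη.le (by linarith [le_abs_self (‖y n‖ ^ 2 - ‖y N‖ ^ 2)])
  obtain ⟨p, hp⟩ := cauchySeq_tendsto_of_complete hcau
  have hTc : Continuous T := (LipschitzWith.of_dist_le_mul (K := 1) (fun a b => by
    simpa [dist_eq_norm] using hT a b)).continuous
  refine ⟨p, ‖z‖, ?_, ?_, ?_⟩
  · have h1 : Tendsto (fun n => y n - T (y n)) atTop (𝓝 (p - T p)) :=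
      hp.sub ((hTc.tendsto p).comp hp)
    have h2 : Tendsto (fun n => y n - T (y n)) atTop (𝓝 (-((0:ℝ) • p))) := by
      simp only [hy]
      exact (hσ0.smul hp).neg
    have := tendsto_nhds_unique h1 h2
    simp only [zero_smul, neg_zero, sub_eq_zero] at this
    exact this.symm
  · intro q hq
    exact le_of_tendsto hp.norm (Eventually.of_forall (hb q hq))
  · intro η hη
    obtain ⟨N, hN⟩ := Metric.tendsto_atTop.1 hp η hη
    refine ⟨σ N, y N, hσ N, hy N, hb z hz N, ?_⟩
    rw [← dist_eq_norm]
    exact hN N le_rfl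

theorem aux_gron (A a D D' : ℝ → ℝ) (c s : ℝ)
    (hA : ∀ t, s ≤ t → HasDerivAt A (a t) t) (hD : ∀ t, s ≤ t → HasDerivAt D (D' t) t)
    (h : ∀ t, s ≤ t → D' t ≤ a t * (c - D t)) (t : ℝ) (ht : s ≤ t) :
    D t - c ≤ (D s - c) * Real.exp (A s - A t) := by
  have hd : ∀ t, s ≤ t → HasDerivAt (fun t => (D t - c) * Real.exp (A t))
      (D' t * Real.exp (A t) + (D t - c) * (Real.exp (A t) * a t)) t := fun t ht =>
    ((hD t ht).sub_const c).mul (hA t ht).exp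
  have hanti : AntitoneOn (fun t => (D t - c) * Real.exp (A t)) (Set.Ici s) := by
    apply antitoneOn_of_deriv_nonpos (convex_Ici s)
    · exact fun t ht => (hd t ht).continuousAt.continuousWithinAt
    · intro t ht
      rw [interior_Ici] at ht
      exact (hd t (le_of_lt ht)).differentiableAt.differentiableWithinAt
    · intro t ht
      rw [interior_Ici] at ht
      rw [(hd t (le_of_lt ht)).deriv]
      have := h t (le_of_lt ht)
      nlinarith [Real.exp_pos (A t)]
  have h1 := hanti (Set.mem_Ici.2 le_rfl) (Set.mem_Ici.2 ht) ht
  simp only at h1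
  rw [Real.exp_sub, ← mul_div_assoc, le_div_iff₀ (Real.exp_pos _)]
  exact h1

/-- Dini-derivative estimate for the residual. -/
theorem aux_dini (T : H → H) (hT : ∀ x y : H, ‖T x - T y‖ ≤ ‖x - y‖)
    (lam eps r R : ℝ → ℝ) (X u : ℝ → H) (M : ℝ)
    (hr : ∀ t, 0 ≤ t → 0 ≤ r t) (hl : ∀ t, 0 ≤ t → 0 < lam t)
    (he : ∀ t, 0 ≤ t → eps t = r t * lam t)
    (hu : ∀ t, 0 ≤ t → u t = T (X t) - (1 + r t) • X t)
    (hX : ∀ t, 0 ≤ t → HasDerivAt X (lam t • u t) t)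
    (hM : ∀ t, 0 ≤ t → ‖X t‖ ≤ M)
    (hR : ∀ s t, 0 ≤ s → s ≤ t → |r t - r s| ≤ R t - R s)
    (hRc : ContinuousOn R (Set.Ici 0)) (huc : ContinuousOn u (Set.Ici 0))
    (G : ℝ → ℝ) (hG : ∀ t, 0 ≤ t → HasDerivWithinAt G (eps t * ‖u t‖) (Set.Ici t) t)
    (hGc : ContinuousOn G (Set.Ici 0))
    (a b : ℝ) (ha : 0 ≤ a) (hab : a ≤ b) :
    ‖u b‖ + G b - M * R b ≤ ‖u a‖ + G a - M * R a := by
  have hsub : Set.Icc a b ⊆ Set.Ici 0 := fun t ht => le_trans ha ht.1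
  have hM0 : 0 ≤ M := (norm_nonneg _).trans (hM 0 le_rfl)
  have key := image_le_of_liminf_slope_right_le_deriv_boundary
    (f := fun t => ‖u t‖ + G t - M * R t) (B' := fun _ => 0)
    (B := fun _ => ‖u a‖ + G a - M * R a) (a := a) (b := b)
    (((huc.mono hsub).norm.add (hGc.mono hsub)).sub (continuousOn_const.mul (hRc.mono hsub)))
    le_rfl continuousOn_const (fun t _ => hasDerivWithinAt_const _ _ _) ?_
  · exact key (Set.right_mem_Icc.2 hab)
  intro t ht ρ hρ
  have ht0 : 0 ≤ t := ha.trans ht.1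
  apply Eventually.frequently
  set κ := ρ / (2 * (3 + r t)) with hκ
  have hrt := hr t ht0
  have hlt := hl t ht0
  have hκ0 : 0 < κ := by positivity
  have hX1 := (hX t ht0).isLittleO.def hκ0
  have hG1 := (hG t ht0).isLittleO.def hκ0
  have hX2 := hX1.filter_mono (nhdsWithin_le_nhds (s := Set.Ioi t))
  have hG2 := hG1.filter_mono (nhdsWithin_mono t Set.Ioi_subset_Ici_self)
  have hsm : ∀ᶠ z in 𝓝[>] t, (1 + r t) * ((z - t) * lam t) < 1 := by
    have hc : Continuous (fun z => (1 + r t) * ((z - t) * lam t)) := by fun_prop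
    have h0 : Tendsto (fun z => (1 + r t) * ((z - t) * lam t)) (𝓝 t) (𝓝 0) := by
      have := hc.tendsto t
      simpa using this
    exact (h0.eventually (gt_mem_nhds one_pos)).filter_mono nhdsWithin_le_nhds
  filter_upwards [hX2, hG2, hsm, self_mem_nhdsWithin] with z h1 h2 h3 h4
  have htz : t < z := h4
  have hz0 : 0 ≤ z := ht0.trans htz.le
  have hpos : 0 < z - t := sub_pos.2 htz
  rw [Real.norm_of_nonneg hpos.le] at h1 h2
  rw [slope_def_field, div_lt_iff₀ hpos]
  set e := X z - X t - (z - t) • lam t • u t with hedef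
  have hu1 : u z = (1 - (1 + r t) * ((z - t) * lam t)) • u t - (1 + r t) • e
      + (T (X z) - T (X t)) - (r z - r t) • X z := by
    rw [hedef, hu z hz0, hu t ht0]
    module
  have hδ : ‖T (X z) - T (X t)‖ ≤ (z - t) * lam t * ‖u t‖ + ‖e‖ := by
    refine (hT _ _).trans ?_
    have : X z - X t = ((z - t) * lam t) • u t + e := by
      rw [hedef, smul_smul]; abel
    rw [this]
    refine (norm_add_le _ _).trans ?_
    rw [norm_smul, Real.norm_of_nonneg (by positivity)]
  have hu2 : ‖u z‖ ≤ (1 - (1 + r t) * ((z - t) * lam t)) * ‖u t‖ + (1 + r t) * ‖e‖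
      + ((z - t) * lam t * ‖u t‖ + ‖e‖) + (R z - R t) * M := by
    rw [hu1]
    refine (norm_sub_le _ _).trans (add_le_add ((norm_add_le _ _).trans
      (add_le_add ((norm_sub_le _ _).trans (add_le_add ?_ ?_)) hδ)) ?_)
    · rw [norm_smul, Real.norm_of_nonneg (by linarith)]
    · rw [norm_smul, Real.norm_of_nonneg (by linarith)]
    · rw [norm_smul, Real.norm_eq_abs]
      have := hR t z ht0 htz.le
      exact mul_le_mul this (hM z hz0) (norm_nonneg _) ((abs_nonneg _).trans this)
  rw [Real.norm_eq_abs, smul_eq_mul, he t ht0] at h2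
  have h5 := le_of_abs_le h2
  have h6 : (2 + r t) * ‖e‖ ≤ (2 + r t) * (κ * (z - t)) :=
    mul_le_mul_of_nonneg_left h1 (by linarith)
  have h7 : (3 + r t) * (κ * (z - t)) = ρ / 2 * (z - t) := by
    rw [hκ]; field_simp
  have h8 : 0 < ρ * (z - t) := mul_pos hρ hpos
  nlinarith

theorem aux_inner (T : H → H) (hT : ∀ x y : H, ‖T x - T y‖ ≤ ‖x - y‖) (q x : H) (hq : T q = q)
    (l e : ℝ) (hl : 0 ≤ l) :
    2 * ⟪x - q, l • (T x - x) - e • x⟫ ≤ -2 * e * (‖x - q‖ ^ 2 + ⟪q, x - q⟫) := by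
  have h := aux_mono T hT x q
  rw [hq, sub_self, sub_zero] at h
  have h1 : ⟪x - q, l • (T x - x) - e • x⟫ = -(l * ⟪x - T x, x - q⟫) - e * ⟪x - q, x⟫ := by
    rw [inner_sub_right, real_inner_smul_right, real_inner_smul_right, ← neg_sub x (T x),
      inner_neg_right, real_inner_comm (x - T x)]
    ring
  have h2 : ⟪x - q, x⟫ = ‖x - q‖ ^ 2 + ⟪q, x - q⟫ := by
    rw [← real_inner_self_eq_norm_sq, real_inner_comm (x - q) q, ← inner_add_right,
      sub_add_cancel]
  rw [h1, h2]
  nlinarith [mul_nonneg hl h]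

theorem aux_core (T : H → H) (hT : ∀ x y : H, ‖T x - T y‖ ≤ ‖x - y‖)
    (hFix : ∃ z : H, T z = z) (lam eps R : ℝ → ℝ) (X : ℝ → H)
    (hlc : Continuous lam) (hec : Continuous eps) (hl : ∀ t, 0 < lam t) (he : ∀ t, 0 ≤ eps t)
    (hr0 : Tendsto (fun t => eps t / lam t) atTop (𝓝 0))
    (hXc : Continuous X)
    (hX : ∀ t, 0 ≤ t → HasDerivAt X (lam t • (T (X t) - X t) - eps t • X t) t)
    (hR : ∀ s t, 0 ≤ s → s ≤ t → |eps t / lam t - eps s / lam s| ≤ R t - R s)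
    (hRc : Continuous R) (C : ℝ) (hRC : ∀ t, 0 ≤ t → R t ≤ C)
    (hE : Tendsto (fun t => ∫ s in (0:ℝ)..t, eps s) atTop atTop) :
    ∃ p : H, T p = p ∧ (∀ q : H, T q = q → ‖p‖ ≤ ‖q‖) ∧ Tendsto X atTop (𝓝 p) := by
  obtain ⟨p, K, hp, hpmin, htik⟩ := aux_tik T hT hFix
  refine ⟨p, hp, hpmin, ?_⟩
  have hTc : Continuous T := (LipschitzWith.of_dist_le_mul (K := 1) (fun a b => by
    simpa [dist_eq_norm] using hT a b)).continuous
  set E : ℝ → ℝ := fun t => ∫ s in (0:ℝ)..t, eps s with hEdef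
  have hEd : ∀ t, HasDerivAt E (eps t) t := fun t =>
    intervalIntegral.integral_hasDerivAt_right (hec.intervalIntegrable _ _)
      (hec.stronglyMeasurableAtFilter _ _) hec.continuousAt
  have hEm : Monotone E := monotone_of_deriv_nonneg (fun t => (hEd t).differentiableAt)
    (fun t => by rw [(hEd t).deriv]; exact he t)
  -- squared distance
  have hD : ∀ t, 0 ≤ t → HasDerivAt (fun t => ‖X t - p‖ ^ 2)
      (2 * ⟪X t - p, lam t • (T (X t) - X t) - eps t • X t⟫) t := fun t ht =>
    ((hX t ht).sub_const p).norm_sq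
  have hDle := fun t => aux_inner T hT p (X t) hp (lam t) (eps t) (hl t).le
  -- boundedness
  obtain ⟨M, hM⟩ : ∃ M, ∀ t, 0 ≤ t → ‖X t‖ ≤ M := by
    refine ⟨‖p‖ ^ 2 + |‖X 0 - p‖ ^ 2 - ‖p‖ ^ 2| + 1 + ‖p‖, fun t ht => ?_⟩
    have h := aux_gron E eps _ _ (‖p‖ ^ 2) 0 (fun t _ => hEd t) hD (fun t ht => by
      refine (hDle t).trans ?_
      have h1 := abs_real_inner_le_norm p (X t - p)
      have h2 := neg_le_of_abs_le h1
      nlinarith [he t, mul_nonneg (he t) (sq_nonneg (‖p‖ - ‖X t - p‖)),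
        mul_le_mul_of_nonneg_left h2 (he t)]) t ht
    have h3 : Real.exp (E 0 - E t) ≤ 1 := Real.exp_le_one_iff.2 (by linarith [hEm ht])
    have h4 : (‖X 0 - p‖ ^ 2 - ‖p‖ ^ 2) * Real.exp (E 0 - E t) ≤ |‖X 0 - p‖ ^ 2 - ‖p‖ ^ 2| := by
      refine (le_abs_self _).trans ?_
      rw [abs_mul, abs_of_pos (Real.exp_pos _)]
      exact mul_le_of_le_one_right (abs_nonneg _) h3
    have h5 : ‖X t‖ ≤ ‖X t - p‖ + ‖p‖ := by
      simpa using norm_add_le (X t - p) p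
    nlinarith [sq_nonneg (‖X t - p‖ - 1), sq_nonneg (‖X t - p‖)]
  have hM0 : 0 ≤ M := (norm_nonneg _).trans (hM 0 le_rfl)
  -- residual
  set r : ℝ → ℝ := fun t => eps t / lam t with hrdef
  have hrc : Continuous r := hec.div hlc (fun t => (hl t).ne')
  have hrnn : ∀ t, 0 ≤ r t := fun t => div_nonneg (he t) (hl t).le
  have her : ∀ t, eps t = r t * lam t := fun t => (div_mul_cancel₀ _ (hl t).ne').symm
  set u : ℝ → H := fun t => T (X t) - (1 + r t) • X t with hudef
  have huc : Continuous u := (hTc.comp hXc).sub ((continuous_const.add hrc).smul hXc)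
  have hXu : ∀ t, 0 ≤ t → HasDerivAt X (lam t • u t) t := fun t ht => by
    have : lam t • u t = lam t • (T (X t) - X t) - eps t • X t := by
      rw [hudef, her t]; module
    rw [this]; exact hX t ht
  have hgc : Continuous (fun t => eps t * ‖u t‖) := hec.mul huc.norm
  set G : ℝ → ℝ := fun t => ∫ s in (0:ℝ)..t, eps s * ‖u s‖ with hGdef
  have hGd : ∀ t, HasDerivAt G (eps t * ‖u t‖) t := fun t =>
    intervalIntegral.integral_hasDerivAt_right (hgc.intervalIntegrable _ _)
      (hgc.stronglyMeasurableAtFilter _ _) hgc.continuousAt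
  have hdini : ∀ a b, 0 ≤ a → a ≤ b →
      ‖u b‖ + G b - M * R b ≤ ‖u a‖ + G a - M * R a := fun a b ha hab =>
    aux_dini T hT lam eps r R X u M (fun t _ => hrnn t) (fun t _ => hl t) (fun t _ => her t)
      (fun t _ => rfl) hXu hM hR hRc.continuousOn huc.continuousOn G
      (fun t _ => (hGd t).hasDerivWithinAt)
      (fun t _ => (hGd t).continuousAt.continuousWithinAt) a b ha hab
  have hGge : ∀ c s t, s ≤ t → (∀ z, s ≤ z → c ≤ ‖u z‖) → c * (E t - E s) ≤ G t - G s := by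
    intro c s t hst hc
    have : MonotoneOn (fun t => G t - c * E t) (Set.Ici s) := by
      have hd : ∀ z, HasDerivAt (fun t => G t - c * E t) (eps z * ‖u z‖ - c * eps z) z :=
        fun z => (hGd z).sub ((hEd z).const_mul c)
      apply monotoneOn_of_deriv_nonneg (convex_Ici s)
      · exact fun t ht => (hd t).continuousAt.continuousWithinAt
      · exact fun t ht => (hd t).differentiableAt.differentiableWithinAt
      · intro z hz
        rw [interior_Ici] at hz
        rw [(hd z).deriv]
        nlinarith [mul_le_mul_of_nonneg_left (hc z (le_of_lt hz)) (he z)]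
    have h := this (Set.mem_Ici.2 le_rfl) (Set.mem_Ici.2 hst) hst
    simp only at h
    linarith
  have hu0 : Tendsto (fun t => ‖u t‖) atTop (𝓝 0) := by
    rw [Metric.tendsto_atTop]
    intro η hη
    -- tail of R is small
    obtain ⟨t1, ht10, ht1⟩ : ∃ t1, 0 ≤ t1 ∧ ∀ t, t1 ≤ t → M * (R t - R t1) ≤ η / 2 := by
      have hRm : ∀ s t, 0 ≤ s → s ≤ t → R s ≤ R t := fun s t hs hst => by
        linarith [(abs_nonneg _).trans (hR s t hs hst)]
      set S := R '' Set.Ici 0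
      have hSb : BddAbove S := ⟨C, by rintro _ ⟨t, ht, rfl⟩; exact hRC t ht⟩
      have hSn : S.Nonempty := ⟨R 0, 0, Set.mem_Ici.2 le_rfl, rfl⟩
      obtain ⟨_, ⟨t1, ht1, rfl⟩, h⟩ := exists_lt_of_lt_csSup hSn
        (show sSup S - η / (2 * (M + 1)) < sSup S by
          have : 0 < η / (2 * (M + 1)) := by positivity
          linarith)
      refine ⟨t1, ht1, fun t ht => ?_⟩
      have h2 : R t ≤ sSup S := le_csSup hSb ⟨t, (Set.mem_Ici.1 ht1).trans ht, rfl⟩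
      have h3 : (M + 1) * (η / (2 * (M + 1))) = η / 2 := by field_simp
      have h4 := hRm t1 t ht1 ht
      nlinarith
    -- some point with small residual
    obtain ⟨t2, ht2, hu2⟩ : ∃ t2, t1 ≤ t2 ∧ ‖u t2‖ < η / 2 := by
      by_contra hc
      push Not at hc
      obtain ⟨t, htt, hEt⟩ := ((eventually_ge_atTop t1).and (hE.eventually_gt_atTop
        (E t1 + (‖u t1‖ + η / 2) / (η / 2)))).exists
      have h1 := hGge (η / 2) t1 t htt hc
      have h2 := hdini t1 t ht10 htt
      have h3 := ht1 t htt
      have h4 : (‖u t1‖ + η / 2) / (η / 2) * (η / 2) = ‖u t1‖ + η / 2 := by field_simp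
      have h5 : E t1 + (‖u t1‖ + η / 2) / (η / 2) < E t := hEt
      have h6 := hc t htt
      nlinarith
    refine ⟨t2, fun t ht => ?_⟩
    rw [Real.dist_eq, sub_zero, abs_of_nonneg (norm_nonneg _)]
    have h2 := hdini t2 t (ht10.trans ht2) ht
    have h3 := ht1 t (ht2.trans ht)
    have h4 := hGge 0 t2 t ht (fun z _ => norm_nonneg _)
    have h5 : R t1 ≤ R t2 := by
      linarith [(abs_nonneg _).trans (hR t1 t2 ht10 ht2)]
    nlinarith
  have hres : Tendsto (fun t => ‖u t‖ + r t * M) atTop (𝓝 0) := by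
    have := hu0.add (hr0.mul_const M)
    simpa using this
  have hres2 : ∀ t, 0 ≤ t → ‖X t - T (X t)‖ ≤ ‖u t‖ + r t * M := fun t ht => by
    have h1 : X t - T (X t) = -(u t + r t • X t) := by rw [hudef]; module
    rw [h1, norm_neg]
    refine (norm_add_le _ _).trans (add_le_add le_rfl ?_)
    rw [norm_smul, Real.norm_of_nonneg (hrnn t)]
    exact mul_le_mul_of_nonneg_left (hM t ht) (hrnn t)
  -- limsup estimate
  have hlim : ∀ η > 0, ∀ᶠ t in atTop, -⟪p, X t - p⟫ ≤ η := by
    intro η hη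
    set B := M + |K| + ‖p‖ + 1 with hB
    have hB0 : 0 < B := by positivity
    obtain ⟨s, y, hs, hy, hyK, hyp⟩ := htik (η / (2 * B)) (by positivity)
    have hev := hres.eventually (gt_mem_nhds (show 0 < s * η / (2 * B) by positivity))
    filter_upwards [hev, eventually_ge_atTop 0] with t h1 ht
    have h2 := (hres2 t ht).trans h1.le
    have h3 := aux_mono T hT (X t) y
    rw [hy, inner_sub_left, inner_neg_left, real_inner_smul_left] at h3
    have h4 := real_inner_le_norm (X t - T (X t)) (X t - y)
    have h5 : ‖X t - y‖ ≤ M + |K| :=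
      (norm_sub_le _ _).trans (add_le_add (hM t ht) (hyK.trans (le_abs_self K)))
    have h6 : ‖X t - T (X t)‖ * ‖X t - y‖ ≤ s * η / (2 * B) * B :=
      mul_le_mul h2 (by rw [hB]; linarith [norm_nonneg p]) (norm_nonneg _) (by positivity)
    have h7 : s * η / (2 * B) * B = s * (η / 2) := by field_simp
    have h8 : -⟪y, X t - y⟫ ≤ η / 2 := by
      by_contra hc
      push Not at hc
      have := mul_lt_mul_of_pos_left hc hs
      linarith
    have h9 : -⟪p, X t - p⟫ = -⟪y, X t - y⟫ + ⟪y - p, X t - y⟫ - ⟪p, y - p⟫ := by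
      simp only [inner_sub_left, inner_sub_right]; ring
    have h10 := real_inner_le_norm (y - p) (X t - y)
    have h11 := neg_le_of_abs_le (abs_real_inner_le_norm p (y - p))
    have h12 : ‖y - p‖ * B ≤ η / (2 * B) * B := mul_le_mul_of_nonneg_right hyp.le hB0.le
    have h13 : η / (2 * B) * B = η / 2 := by field_simp
    have h14 := mul_le_mul_of_nonneg_left h5 (norm_nonneg (y - p))
    rw [hB] at h12 h13
    nlinarith [norm_nonneg (y - p)]
  -- conclusion
  rw [Metric.tendsto_atTop']
  intro η hη
  obtain ⟨s, hs⟩ := eventually_atTop.1 ((hlim (η ^ 2 / 2) (by positivity)).and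
    (eventually_ge_atTop 0))
  have hs0 : 0 ≤ s := (hs s le_rfl).2
  have hg := aux_gron (fun t => 2 * E t) (fun t => 2 * eps t) (fun t => ‖X t - p‖ ^ 2) _
    (η ^ 2 / 2) s (fun t _ => (hEd t).const_mul 2) (fun t ht => hD t (hs0.trans ht)) (fun t ht => by
      refine (hDle t).trans ?_
      nlinarith [mul_le_mul_of_nonneg_left (hs t ht).1 (he t)])
  have hlimit : Tendsto (fun t => (‖X s - p‖ ^ 2 - η ^ 2 / 2) * Real.exp (2 * E s - 2 * E t))
      atTop (𝓝 0) := by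
    have h1 : Tendsto (fun t => 2 * E s - 2 * E t) atTop atBot := by
      have : Tendsto (fun t => 2 * E t) atTop atTop := hE.const_mul_atTop two_pos
      simpa [sub_eq_add_neg] using tendsto_atBot_add_const_left atTop (2 * E s)
        (tendsto_neg_atTop_atBot.comp this)
    simpa using (Real.tendsto_exp_atBot.comp h1).const_mul (‖X s - p‖ ^ 2 - η ^ 2 / 2)
  obtain ⟨t0, ht0⟩ := eventually_atTop.1 ((hlimit.eventually
    (gt_mem_nhds (show 0 < η ^ 2 / 2 by positivity))).and (eventually_ge_atTop s))
  refine ⟨t0, fun t ht => ?_⟩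
  obtain ⟨h1, h2⟩ := ht0 t ht.le
  have h3 := hg t h2
  rw [dist_eq_norm]
  exact lt_of_pow_lt_pow_left₀ 2 hη.le (by linarith)

theorem stmt4 (T : H → H) (hT : ∀ x y : H, ‖T x - T y‖ ≤ ‖x - y‖)
    (hFix : ∃ z : H, T z = z)
    (lam eps : ℝ → ℝ) (hlam_meas : Measurable lam) (heps_meas : Measurable eps)
    (hlam_range : ∀ t : ℝ, 0 ≤ t → lam t ∈ Set.Ioc (0:ℝ) 1)
    (heps_range : ∀ t : ℝ, 0 ≤ t → 0 ≤ eps t)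
    (heps_int : ∀ b : ℝ, IntervalIntegrable eps volume 0 b)
    (x₀ : H) (x : ℝ → H)
    (hsol : IsStrongGlobalSolution (fun t w => lam t • (T w - w) - eps t • w) x₀ x)
    -- (i) ∫₀^∞ ε(t) dt = ∞
    (hi : ∫⁻ t in Set.Ioi (0:ℝ), ENNReal.ofReal (eps t) = ⊤)
    -- (ii) ∫₀^∞ λ(t) dt = ∞
    (hii : ∫⁻ t in Set.Ioi (0:ℝ), ENNReal.ofReal (lam t) = ⊤)
    -- (iii) ε and λ are locally absolutely continuous and ε/λ → 0
    (hepsAC : ∃ epsd : ℝ → ℝ, (∀ b : ℝ, IntervalIntegrable epsd volume 0 b) ∧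
      ∀ t : ℝ, 0 ≤ t → eps t = eps 0 + ∫ s in (0:ℝ)..t, epsd s)
    (hlamAC : ∃ lamd : ℝ → ℝ, (∀ b : ℝ, IntervalIntegrable lamd volume 0 b) ∧
      ∀ t : ℝ, 0 ≤ t → lam t = lam 0 + ∫ s in (0:ℝ)..t, lamd s)
    (hratio : Tendsto (fun t => eps t / lam t) atTop (𝓝 (0:ℝ)))
    -- (iv) ∫₀^∞ |(d/dt)(ε(t)/λ(t))| dt < ∞
    (hiv : ∃ rd : ℝ → ℝ,
      (∀ t : ℝ, 0 ≤ t → eps t / lam t = eps 0 / lam 0 + ∫ s in (0:ℝ)..t, rd s) ∧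
      ∫⁻ t in Set.Ioi (0:ℝ), ENNReal.ofReal |rd t| < ⊤) :
    ∃ p : H, T p = p ∧ (∀ q : H, T q = q → ‖p‖ ≤ ‖q‖) ∧
      Tendsto x atTop (𝓝 p) := by
  classical
  obtain ⟨hxc, hfi, hxeq⟩ := hsol
  obtain ⟨epsd, hepsd, hepseq⟩ := hepsAC
  obtain ⟨lamd, hlamd, hlameq⟩ := hlamAC
  obtain ⟨rd, hrdeq, hrdint⟩ := hiv
  have hmax : Continuous (fun t : ℝ => max t 0) := by fun_prop
  have hcont : ∀ (g gd : ℝ → ℝ), (∀ b : ℝ, IntervalIntegrable gd volume 0 b) →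
      (∀ t : ℝ, 0 ≤ t → g t = g 0 + ∫ s in (0:ℝ)..t, gd s) →
      Continuous (fun t => g (max t 0)) := by
    intro g gd h1 h2
    have h3 : (fun t => g (max t 0)) = fun t => g 0 + ∫ s in (0:ℝ)..(max t 0), gd s := by
      ext t; exact h2 _ (le_max_right _ _)
    rw [h3]
    have h4 := intervalIntegral.continuous_primitive (μ := volume)
      (fun a b => (h1 a).symm.trans (h1 b)) 0
    exact continuous_const.add (h4.comp hmax)
  have hTc : Continuous T := (LipschitzWith.of_dist_le_mul (K := 1) (fun a b => by
    simpa [dist_eq_norm] using hT a b)).continuous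
  have hec := hcont eps epsd hepsd hepseq
  have hlc := hcont lam lamd hlamd hlameq
  have hxc' : Continuous (fun t => x (max t 0)) :=
    hxc.comp_continuous hmax (fun t => Set.mem_Ici.2 (le_max_right _ _))
  set F : ℝ → H := fun t => lam (max t 0) • (T (x (max t 0)) - x (max t 0))
    - eps (max t 0) • x (max t 0) with hF
  have hFc : Continuous F :=
    (hlc.smul ((hTc.comp hxc').sub hxc')).sub (hec.smul hxc')
  set X : ℝ → H := fun t => x₀ + ∫ s in (0:ℝ)..t, F s with hXdef
  have hXd : ∀ t, HasDerivAt X (F t) t := fun t =>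
    (intervalIntegral.integral_hasDerivAt_right (hFc.intervalIntegrable _ _)
      (hFc.stronglyMeasurableAtFilter _ _) hFc.continuousAt).const_add x₀
  have hXx : ∀ t, 0 ≤ t → X t = x t := by
    intro t ht
    rw [hXdef, hxeq t ht]
    simp only
    congr 1
    apply intervalIntegral.integral_congr
    intro s hs
    rw [Set.uIcc_of_le ht] at hs
    simp only [hF, max_eq_left hs.1]
  -- divergence of the integral of eps
  have hE : Tendsto (fun t => ∫ s in (0:ℝ)..t, eps (max s 0)) atTop atTop := by
    have hm : Monotone (fun t => ∫ s in (0:ℝ)..t, eps (max s 0)) := by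
      have hd : ∀ t, HasDerivAt (fun t => ∫ s in (0:ℝ)..t, eps (max s 0)) (eps (max t 0)) t :=
        fun t => intervalIntegral.integral_hasDerivAt_right (hec.intervalIntegrable _ _)
          (hec.stronglyMeasurableAtFilter _ _) hec.continuousAt
      exact monotone_of_deriv_nonneg (fun t => (hd t).differentiableAt)
        (fun t => by rw [(hd t).deriv]; exact heps_range _ (le_max_right _ _))
    apply tendsto_atTop_atTop_of_monotone hm
    by_contra hc
    push Not at hc
    obtain ⟨C, hC⟩ := hc
    have hint : IntegrableOn eps (Set.Ioi 0) := by
      refine integrableOn_Ioi_of_intervalIntegral_norm_bounded (l := atTop) (b := fun t : ℝ => t)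
        C 0 (fun t => (heps_int t).1) tendsto_id ?_
      filter_upwards [eventually_ge_atTop 0] with t ht
      have : ∫ s in (0:ℝ)..t, ‖eps s‖ = ∫ s in (0:ℝ)..t, eps (max s 0) := by
        apply intervalIntegral.integral_congr
        intro s hs
        rw [Set.uIcc_of_le ht] at hs
        simp only [max_eq_left hs.1, Real.norm_of_nonneg (heps_range s hs.1)]
      rw [this]
      exact (hC t).le
    have h2 := hint.lintegral_lt_top
    rw [hi] at h2
    exact lt_irrefl _ h2
  -- integrability of rd
  have hrdi : ∀ b, 0 ≤ b → IntervalIntegrable rd volume 0 b := by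
    intro b hb
    by_contra hc
    have hz : ∀ t, b ≤ t → eps t / lam t = eps 0 / lam 0 := by
      intro t ht
      have hni : ¬ IntervalIntegrable rd volume 0 t := fun h => hc (h.mono_set (by
        rw [Set.uIcc_of_le hb, Set.uIcc_of_le (hb.trans ht)]
        exact Set.Icc_subset_Icc_right ht))
      rw [hrdeq t (hb.trans ht), intervalIntegral.integral_undef hni, add_zero]
    have h0 : eps 0 / lam 0 = 0 := by
      refine tendsto_nhds_unique (f := fun t => eps t / lam t) (l := atTop) ?_ hratio
      refine tendsto_const_nhds.congr' ?_
      filter_upwards [eventually_ge_atTop b] with t ht using (hz t ht).symm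
    have he0 : ∀ t, b ≤ t → eps t = 0 := by
      intro t ht
      have h1 := hz t ht
      rw [h0, div_eq_zero_iff] at h1
      exact h1.resolve_right (hlam_range t (hb.trans ht)).1.ne'
    obtain ⟨t, ht1, ht2⟩ := ((hE.eventually_gt_atTop (∫ s in (0:ℝ)..b, eps (max s 0))).and
      (eventually_ge_atTop b)).exists
    have h3 := intervalIntegral.integral_add_adjacent_intervals
      (hec.intervalIntegrable (μ := volume) 0 b) (hec.intervalIntegrable b t)
    have h4 : ∫ s in b..t, eps (max s 0) = 0 := by
      apply intervalIntegral.integral_zero_ae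
      refine Eventually.of_forall fun s hs => ?_
      rw [Set.uIoc_of_le ht2] at hs
      rw [max_eq_left (hb.trans hs.1.le)]
      exact he0 s hs.1.le
    linarith
  have hrdm : AEStronglyMeasurable rd (volume.restrict (Set.Ioi 0)) := by
    have : Set.Ioi (0:ℝ) = ⋃ n : ℕ, Set.Ioc (0:ℝ) n := by
      ext t
      simp only [Set.mem_Ioi, Set.mem_iUnion, Set.mem_Ioc]
      constructor
      · intro h
        obtain ⟨n, hn⟩ := exists_nat_ge t
        exact ⟨n, h, hn⟩
      · rintro ⟨n, h, _⟩; exact h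
    rw [this, aestronglyMeasurable_iUnion_iff]
    exact fun n => (hrdi n (Nat.cast_nonneg n)).1.aestronglyMeasurable
  have hrdI : IntegrableOn rd (Set.Ioi 0) := by
    refine ⟨hrdm, ?_⟩
    rw [hasFiniteIntegral_iff_norm]
    exact hrdint
  set g : ℝ → ℝ := (Set.Ioi (0:ℝ)).indicator (fun t => |rd t|) with hg
  have hgI : Integrable g := (integrable_indicator_iff measurableSet_Ioi).2 hrdI.abs
  have hg0 : ∀ t, 0 ≤ g t := fun t => Set.indicator_nonneg (fun _ _ => abs_nonneg _) t
  have hres := aux_core T hT hFix (fun t => lam (max t 0)) (fun t => eps (max t 0))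
    (fun t => ∫ s in (0:ℝ)..t, g s) X hlc hec
    (fun t => (hlam_range _ (le_max_right _ _)).1) (fun t => heps_range _ (le_max_right _ _))
    ?_ (continuous_iff_continuousAt.2 fun t => (hXd t).continuousAt) ?_ ?_
    (intervalIntegral.continuous_primitive (fun a b => hgI.intervalIntegrable) 0)
    (∫ s, g s) ?_ hE
  · obtain ⟨p, hp, hmin, hlim⟩ := hres
    refine ⟨p, hp, hmin, hlim.congr' ?_⟩
    filter_upwards [eventually_ge_atTop 0] with t ht using hXx t ht
  · refine hratio.congr' ?_
    filter_upwards [eventually_ge_atTop 0] with t ht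
    simp only [max_eq_left ht]
  · intro t ht
    have := hXd t
    rw [hF] at this
    simpa only [max_eq_left ht, hXx t ht] using this
  · intro s t hs hst
    have ht := hs.trans hst
    simp only [max_eq_left hs, max_eq_left ht]
    rw [hrdeq t ht, hrdeq s hs, add_sub_add_left_eq_sub,
      intervalIntegral.integral_interval_sub_left (hrdi t ht) (hrdi s hs),
      intervalIntegral.integral_interval_sub_left hgI.intervalIntegrable hgI.intervalIntegrable]
    refine (intervalIntegral.abs_integral_le_integral_abs hst).trans (le_of_eq ?_)
    apply intervalIntegral.integral_congr_ae
    refine Eventually.of_forall fun z hz => ?_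
    rw [Set.uIoc_of_le hst] at hz
    rw [hg, Set.indicator_of_mem (show z ∈ Set.Ioi (0:ℝ) from hs.trans_lt hz.1)]
  · intro t ht
    rw [intervalIntegral.integral_of_le ht]
    exact setIntegral_le_integral hgI (Eventually.of_forall hg0)
end

section
/- Let H be a real Hilbert space, D ⊆ H a nonempty closed convex set, and T : H → H a nonexpansive map with T(D) ⊆ D and Fix T nonempty. Let λ : [0, ∞) → (0, 1] and ε : [0, ∞) → [0, ∞) be Lebesgue measurable with ε locally integrable. Then for every pair (x₀, y) ∈ D × D the system ẋ(t) = λ(t)·(T(x(t)) − x(t)) − ε(t)·(x(t) − y), x(0) = x₀, admits a unique strong global solution x : [0, ∞) → H, and this solution leaves D forward invariant, i.e. x(t) ∈ D for all t ≥ 0. -/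
open Filter MeasureTheory Set Topology
open scoped RealInnerProductSpace

variable {H : Type*} [NormedAddCommGroup H] [InnerProductSpace ℝ H] [CompleteSpace H]

lemma aux_pow_int (k : ℝ → ℝ) (hk : ∀ b, IntervalIntegrable k volume 0 b) (n : ℕ) (t : ℝ) :
    ∫ s in (0:ℝ)..t, k s * (∫ r in (0:ℝ)..s, k r) ^ n
      = (∫ r in (0:ℝ)..t, k r) ^ (n + 1) / (n + 1) := by
  have hac : AbsolutelyContinuousOnInterval (fun s => ∫ r in (0:ℝ)..s, k r) 0 t :=
    (hk t).absolutelyContinuousOnInterval_intervalIntegral (by simp)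
  have hpow : ∀ m : ℕ, AbsolutelyContinuousOnInterval
      (fun s => (∫ r in (0:ℝ)..s, k r) ^ (m + 1)) 0 t := by
    intro m
    induction m with
    | zero => simpa using hac
    | succ m ih =>
      have := ih.fun_mul hac
      simpa [pow_succ] using this
  have h := (hpow n).integral_deriv_eq_sub
  have h2 : ∫ s in (0:ℝ)..t, deriv (fun s => (∫ r in (0:ℝ)..s, k r) ^ (n + 1)) s
      = ∫ s in (0:ℝ)..t, ((n:ℝ) + 1) * (k s * (∫ r in (0:ℝ)..s, k r) ^ n) := by
    apply intervalIntegral.integral_congr_ae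
    filter_upwards [(hk t).ae_hasDerivAt_integral] with s hs hst
    have := ((hs (uIoc_subset_uIcc hst) 0 (by simp)).fun_pow (n + 1)).deriv
    rw [this]
    push_cast
    ring
  rw [h2, intervalIntegral.integral_const_mul] at h
  have hn : (n:ℝ) + 1 ≠ 0 := by positivity
  rw [eq_div_iff hn, mul_comm, h]
  simp

lemma aux_int_ab {E : Type*} [NormedAddCommGroup E] {k : ℝ → E}
    (hk : ∀ b, IntervalIntegrable k volume 0 b) (a b : ℝ) :
    IntervalIntegrable k volume a b := (hk a).symm.trans (hk b)

lemma aux_step (k : ℝ → ℝ) (hk : ∀ b, IntervalIntegrable k volume 0 b)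
    (C : ℝ) (n : ℕ) (g : ℝ → H) (t : ℝ) (ht : 0 ≤ t)
    (hg : ∀ s, 0 ≤ s → s ≤ t → ‖g s‖ ≤ k s * (C * (∫ r in (0:ℝ)..s, k r) ^ n / n.factorial)) :
    ‖∫ s in (0:ℝ)..t, g s‖ ≤ C * (∫ r in (0:ℝ)..t, k r) ^ (n + 1) / (n + 1).factorial := by
  have hKc : Continuous (fun s => ∫ r in (0:ℝ)..s, k r) :=
    intervalIntegral.continuous_primitive (aux_int_ab hk) 0
  have h1 : ‖∫ s in (0:ℝ)..t, g s‖ ≤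
      ∫ s in (0:ℝ)..t, k s * (C * (∫ r in (0:ℝ)..s, k r) ^ n / n.factorial) := by
    apply intervalIntegral.norm_integral_le_of_norm_le ht
    · exact Eventually.of_forall fun s hs => hg s hs.1.le hs.2
    · apply (hk t).mul_continuousOn
      fun_prop
  refine h1.trans (le_of_eq ?_)
  have h2 : (fun s => k s * (C * (∫ r in (0:ℝ)..s, k r) ^ n / n.factorial))
      = fun s => (C / n.factorial) * (k s * (∫ r in (0:ℝ)..s, k r) ^ n) := by
    ext s; ring
  rw [h2, intervalIntegral.integral_const_mul, aux_pow_int k hk, Nat.factorial_succ]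
  push_cast
  have hn : (n:ℝ) + 1 ≠ 0 := by positivity
  have hf : (n.factorial:ℝ) ≠ 0 := by positivity
  field_simp

lemma aux_unique (k : ℝ → ℝ) (hk0 : ∀ t, 0 ≤ k t) (hk : ∀ b, IntervalIntegrable k volume 0 b)
    (f : ℝ → H → H) (hL : ∀ t, 0 ≤ t → ∀ u v, ‖f t u - f t v‖ ≤ k t * ‖u - v‖)
    (x₀ : H) (x x' : ℝ → H) (hx : IsStrongGlobalSolution f x₀ x)
    (hx' : IsStrongGlobalSolution f x₀ x') (t : ℝ) (ht : 0 ≤ t) : x' t = x t := by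
  obtain ⟨hc, hi, he⟩ := hx
  obtain ⟨hc', hi', he'⟩ := hx'
  have hcd : ContinuousOn (fun s => x' s - x s) (Icc 0 t) :=
    (hc'.sub hc).mono Icc_subset_Ici_self
  obtain ⟨C, hC⟩ := isCompact_Icc.exists_bound_of_continuousOn hcd
  have key : ∀ n : ℕ, ∀ s, 0 ≤ s → s ≤ t →
      ‖x' s - x s‖ ≤ C * (∫ r in (0:ℝ)..s, k r) ^ n / n.factorial := by
    intro n
    induction n with
    | zero => intro s h0 h1; simpa using hC s ⟨h0, h1⟩
    | succ n ih =>
      intro s h0 h1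
      have : x' s - x s = ∫ r in (0:ℝ)..s, (f r (x' r) - f r (x r)) := by
        rw [intervalIntegral.integral_sub (hi' s) (hi s), he s h0, he' s h0]; abel
      rw [this]
      apply aux_step k hk C n _ s h0
      intro r hr0 hr1
      exact (hL r hr0 _ _).trans (mul_le_mul_of_nonneg_left (ih r hr0 (hr1.trans h1)) (hk0 r))
  have hlim : Tendsto (fun n : ℕ => C * (∫ r in (0:ℝ)..t, k r) ^ n / n.factorial) atTop (𝓝 0) := by
    have := (FloorSemiring.tendsto_pow_div_factorial_atTop (∫ r in (0:ℝ)..t, k r)).const_mul C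
    simpa [mul_div_assoc] using this
  have h0 : ‖x' t - x t‖ ≤ 0 := ge_of_tendsto' hlim fun n => key n t ht le_rfl
  exact sub_eq_zero.1 (norm_le_zero_iff.1 h0)

/-- Picard iterates, frozen for negative times. -/
noncomputable def auxPicard (f : ℝ → H → H) (x₀ : H) : ℕ → ℝ → H
  | 0 => fun _ => x₀
  | n + 1 => fun t => x₀ + ∫ s in (0:ℝ)..(max t 0), f s (auxPicard f x₀ n s)

lemma aux_exists_s5 (k : ℝ → ℝ) (hk0 : ∀ t, 0 ≤ k t) (hk : ∀ b, IntervalIntegrable k volume 0 b)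
    (f : ℝ → H → H) (hL : ∀ t, ∀ u v, ‖f t u - f t v‖ ≤ k t * ‖u - v‖)
    (hI : ∀ x : ℝ → H, Continuous x → ∀ b, IntervalIntegrable (fun s => f s (x s)) volume 0 b)
    (x₀ : H) : ∃ x : ℝ → H, Continuous x ∧
      ∀ t, 0 ≤ t → x t = x₀ + ∫ s in (0:ℝ)..t, f s (x s) := by
  set X := auxPicard f x₀ with hX
  have hX0 : ∀ t, X 0 t = x₀ := fun t => rfl
  have hXs : ∀ n t, X (n+1) t = x₀ + ∫ s in (0:ℝ)..(max t 0), f s (X n s) := fun n t => rfl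
  have hXc : ∀ n, Continuous (X n) := by
    intro n
    induction n with
    | zero => exact continuous_const
    | succ n ih =>
      have h1 : Continuous fun b => ∫ s in (0:ℝ)..b, f s (X n s) :=
        intervalIntegral.continuous_primitive (aux_int_ab (hI _ ih)) 0
      exact continuous_const.add (h1.comp (continuous_id.max continuous_const))
  set K : ℝ → ℝ := fun s => ∫ r in (0:ℝ)..s, k r with hK
  have hK0 : ∀ t, 0 ≤ t → 0 ≤ K t := fun t ht =>
    intervalIntegral.integral_nonneg ht fun s _ => hk0 s
  have hKm : ∀ s t, 0 ≤ s → s ≤ t → K s ≤ K t := fun s t h0 h1 =>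
    intervalIntegral.integral_mono_interval le_rfl h0 h1 (Eventually.of_forall hk0) (hk t)
  have hf0 : ∀ b, IntervalIntegrable (fun s => f s x₀) volume 0 b := hI _ continuous_const
  set G : ℝ → ℝ := fun b => ∫ s in (0:ℝ)..b, ‖f s x₀‖ with hG
  have hG0 : ∀ b, 0 ≤ b → 0 ≤ G b := fun t ht =>
    intervalIntegral.integral_nonneg ht fun s _ => norm_nonneg _
  have key : ∀ b, 0 ≤ b → ∀ n : ℕ, ∀ t, t ≤ b →
      ‖X (n+1) t - X n t‖ ≤ G b * (K (max t 0)) ^ n / n.factorial := by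
    intro b hb n
    induction n with
    | zero =>
      intro t ht
      have h0 : 0 ≤ max t 0 := le_max_right _ _
      have : X (0+1) t - X 0 t = ∫ s in (0:ℝ)..(max t 0), f s x₀ := by
        rw [hXs, hX0]; simp [hX0]
      rw [this]
      simp only [pow_zero, mul_one, Nat.factorial_zero, Nat.cast_one, div_one]
      refine (intervalIntegral.norm_integral_le_integral_norm h0).trans ?_
      exact intervalIntegral.integral_mono_interval le_rfl h0 (max_le ht hb)
        (Eventually.of_forall fun s => norm_nonneg _) (hf0 b).norm
    | succ n ih =>
      intro t ht
      have h0 : 0 ≤ max t 0 := le_max_right _ _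
      have : X (n+1+1) t - X (n+1) t
          = ∫ s in (0:ℝ)..(max t 0), (f s (X (n+1) s) - f s (X n s)) := by
        rw [intervalIntegral.integral_sub (hI _ (hXc _) _) (hI _ (hXc _) _), hXs (n+1), hXs n]
        abel
      rw [this]
      apply aux_step k hk (G b) n _ _ h0
      intro r hr0 hr1
      refine (hL r _ _).trans (mul_le_mul_of_nonneg_left ?_ (hk0 r))
      have := ih r (hr1.trans (max_le ht hb))
      rwa [max_eq_left hr0] at this
  have key2 : ∀ b, 0 ≤ b → ∀ n : ℕ, ∀ t, t ≤ b →
      ‖X (n+1) t - X n t‖ ≤ G b * (K b) ^ n / n.factorial := by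
    intro b hb n t ht
    refine (key b hb n t ht).trans ?_
    have h0 : 0 ≤ max t 0 := le_max_right _ _
    have := hKm _ b h0 (max_le ht hb)
    have := hK0 _ h0
    have := hG0 b hb
    gcongr
  have hsum : ∀ b, Summable fun n : ℕ => G b * (K b) ^ n / n.factorial := by
    intro b
    have := (Real.summable_pow_div_factorial (K b)).mul_left (G b)
    simpa [mul_div_assoc] using this
  have hpart : ∀ n t, X n t = x₀ + ∑ i ∈ Finset.range n, (X (i+1) t - X i t) := by
    intro n t
    rw [Finset.sum_range_sub (fun i => X i t), hX0]; abel
  let x : ℝ → H := fun t => x₀ + ∑' n, (X (n+1) t - X n t)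
  have hs : ∀ t, Summable fun n => X (n+1) t - X n t := fun t =>
    Summable.of_norm_bounded (hsum (max t 0)) fun n =>
      key2 _ (le_max_right _ _) n t (le_max_left _ _)
  have hlim : ∀ t, Tendsto (fun n => X n t) atTop (𝓝 (x t)) := by
    intro t
    have := (hs t).hasSum.tendsto_sum_nat.const_add x₀
    exact this.congr fun n => (hpart n t).symm
  have hxc : Continuous x := by
    rw [continuous_iff_continuousAt]
    intro t
    have hb : 0 ≤ max t 0 + 1 := by positivity
    have hcon : ContinuousOn (fun t => ∑' n, (X (n+1) t - X n t)) (Iic (max t 0 + 1)) :=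
      continuousOn_tsum (fun n => ((hXc _).sub (hXc _)).continuousOn) (hsum (max t 0 + 1))
        fun n s hs => key2 _ hb n s hs
    exact continuousAt_const.add (hcon.continuousAt
      (Iic_mem_nhds (lt_of_le_of_lt (le_max_left t 0) (lt_add_one _))))
  refine ⟨x, hxc, fun t ht => ?_⟩
  have hL1 : Tendsto (fun n => X (n+1) t) atTop (𝓝 (x t)) := (hlim t).comp (tendsto_add_atTop_nat 1)
  have hL2 : Tendsto (fun n => ∫ s in (0:ℝ)..t, f s (X n s)) atTop
      (𝓝 (∫ s in (0:ℝ)..t, f s (x s))) := by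
    set B := ∑' n : ℕ, G t * (K t) ^ n / n.factorial with hB
    apply intervalIntegral.tendsto_integral_filter_of_dominated_convergence
      (fun s => ‖f s x₀‖ + k s * B)
    · refine Eventually.of_forall fun n => ?_
      exact (hI _ (hXc n) t).def'.aestronglyMeasurable
    · refine Eventually.of_forall fun n => Eventually.of_forall fun s hs => ?_
      rw [uIoc_of_le ht] at hs
      have h1 : ‖X n s - x₀‖ ≤ B := by
        rw [hpart n s, add_sub_cancel_left]
        refine (norm_sum_le _ _).trans ((Finset.sum_le_sum fun i _ =>
          key2 t ht i s hs.2).trans ?_)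
        refine (hsum t).sum_le_tsum _ fun i _ => ?_
        have := hK0 t ht
        have := hG0 t ht
        positivity
      have h2 := (hL s (X n s) x₀).trans (mul_le_mul_of_nonneg_left h1 (hk0 s))
      have h3 := norm_le_norm_add_norm_sub' (f s (X n s)) (f s x₀)
      linarith
    · exact (hf0 t).norm.add ((hk t).mul_const B)
    · refine Eventually.of_forall fun s _ => ?_
      rw [tendsto_iff_norm_sub_tendsto_zero]
      have h1 := ((tendsto_iff_norm_sub_tendsto_zero.1 (hlim s)).const_mul (k s))
      rw [mul_zero] at h1
      exact squeeze_zero (fun _ => norm_nonneg _) (fun n => hL s _ _) h1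
  have hL3 := hL2.const_add x₀
  refine tendsto_nhds_unique hL1 (hL3.congr fun n => ?_)
  rw [hXs, max_eq_left ht]

lemma aux_nonpos (φ q : ℝ → ℝ) (hφ : Continuous φ) (h0 : φ 0 ≤ 0)
    (hq : ∀ b, IntervalIntegrable q volume 0 b)
    (he : ∀ t, 0 ≤ t → φ t = φ 0 + ∫ s in (0:ℝ)..t, q s)
    (hneg : ∀ t, 0 ≤ t → 0 < φ t → q t ≤ 0) (t : ℝ) (ht : 0 ≤ t) : φ t ≤ 0 := by
  by_contra! hpos
  let S : Set ℝ := Icc 0 t ∩ φ ⁻¹' Iic 0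
  have hS : IsCompact S := isCompact_Icc.inter_right (isClosed_Iic.preimage hφ)
  have hne : S.Nonempty := ⟨0, ⟨le_rfl, ht⟩, h0⟩
  obtain ⟨m, hmS, hmax⟩ := hS.exists_isGreatest hne
  have hm0 : 0 ≤ m := hmS.1.1
  have hmt : m ≤ t := hmS.1.2
  have hmφ : φ m ≤ 0 := hmS.2
  have hgt : ∀ s, m < s → s ≤ t → 0 < φ s := by
    intro s h1 h2
    by_contra! h
    exact absurd (hmax ⟨⟨hm0.trans h1.le, h2⟩, h⟩) (not_le.2 h1)
  have hdiff : φ t - φ m = ∫ s in m..t, q s := by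
    rw [he t ht, he m hm0, ← intervalIntegral.integral_interval_sub_left (hq t) (hq m)]
    ring
  have hle : ∫ s in m..t, q s ≤ ∫ s in m..t, (0:ℝ) := by
    apply intervalIntegral.integral_mono_on_of_le_Ioo hmt (aux_int_ab hq m t) (by simp)
    intro s hs
    exact hneg s (hm0.trans hs.1.le) (hgt s hs.1 hs.2.le)
  simp at hle
  linarith

lemma aux_proj (D : Set H) (hDne : D.Nonempty) (hDcl : IsClosed D) (hDconv : Convex ℝ D) :
    ∃ P : H → H, (∀ u, P u ∈ D) ∧ (∀ u ∈ D, P u = u) ∧ ∀ u v, ‖P u - P v‖ ≤ ‖u - v‖ := by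
  choose P hPD hP using exists_norm_eq_iInf_of_complete_convex hDne hDcl.isComplete hDconv
  have hin : ∀ u, ∀ w ∈ D, ⟪u - P u, w - P u⟫ ≤ 0 := fun u =>
    (norm_eq_iInf_iff_real_inner_le_zero hDconv (hPD u)).1 (hP u)
  refine ⟨P, hPD, fun u hu => ?_, fun u v => ?_⟩
  · have h := hin u u hu
    rw [real_inner_self_eq_norm_sq] at h
    have : ‖u - P u‖ = 0 := by nlinarith [norm_nonneg (u - P u)]
    exact (sub_eq_zero.1 (norm_eq_zero.1 this)).symm
  · have h1 := hin u (P v) (hPD v)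
    have h2 := hin v (P u) (hPD u)
    have h3 : ⟪P u - P v, P u - P v⟫ ≤ ⟪u - v, P u - P v⟫ := by
      have e : ⟪u - v, P u - P v⟫ - ⟪P u - P v, P u - P v⟫
          = - ⟪u - P u, P v - P u⟫ - ⟪v - P v, P u - P v⟫ := by
        simp only [inner_sub_left, inner_sub_right]; ring
      linarith
    rw [real_inner_self_eq_norm_sq] at h3
    have h4 := real_inner_le_norm (u - v) (P u - P v)
    by_contra! h
    nlinarith [norm_nonneg (u - v), norm_nonneg (P u - P v)]

theorem stmt5 (D : Set H) (hDne : D.Nonempty) (hDcl : IsClosed D) (hDconv : Convex ℝ D)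
    (T : H → H) (hT : ∀ x y : H, ‖T x - T y‖ ≤ ‖x - y‖)
    (hTD : ∀ z ∈ D, T z ∈ D)
    (hFix : ∃ z : H, T z = z)
    (lam eps : ℝ → ℝ) (hlam_meas : Measurable lam) (heps_meas : Measurable eps)
    (hlam_range : ∀ t : ℝ, 0 ≤ t → lam t ∈ Set.Ioc (0:ℝ) 1)
    (heps_range : ∀ t : ℝ, 0 ≤ t → 0 ≤ eps t)
    (heps_int : ∀ b : ℝ, IntervalIntegrable eps volume 0 b)
    (x₀ y : H) (hx₀ : x₀ ∈ D) (hy : y ∈ D) :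
    ∃ x : ℝ → H,
      IsStrongGlobalSolution (fun t w => lam t • (T w - w) - eps t • (w - y)) x₀ x ∧
      (∀ t : ℝ, 0 ≤ t → x t ∈ D) ∧
      ∀ x' : ℝ → H,
        IsStrongGlobalSolution (fun t w => lam t • (T w - w) - eps t • (w - y)) x₀ x' →
        ∀ t : ℝ, 0 ≤ t → x' t = x t := by
  classical
  obtain ⟨z, hz⟩ := hFix
  obtain ⟨P, hPD, hPid, hPn⟩ := aux_proj D hDne hDcl hDconv
  have hTc : Continuous T := (LipschitzWith.of_dist_le_mul (K := 1) fun u v => by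
    simpa [dist_eq_norm] using hT u v).continuous
  have hPc : Continuous P := (LipschitzWith.of_dist_le_mul (K := 1) fun u v => by
    simpa [dist_eq_norm] using hPn u v).continuous
  let k : ℝ → ℝ := fun t => 2 + |eps t|
  have hk0 : ∀ t, 0 ≤ k t := fun t => by positivity
  have hk : ∀ b, IntervalIntegrable k volume 0 b := fun b =>
    intervalIntegrable_const.add (heps_int b).abs
  have hLip : ∀ (l e : ℝ) (U : H → H), (∀ u v, ‖U u - U v‖ ≤ ‖u - v‖) → 0 ≤ l → l ≤ 1 →
      ∀ u v : H, ‖(l • (U u - u) - e • (u - y)) - (l • (U v - v) - e • (v - y))‖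
        ≤ (2 + |e|) * ‖u - v‖ := by
    intro l e U hU h0 h1 u v
    have e1 : (l • (U u - u) - e • (u - y)) - (l • (U v - v) - e • (v - y))
        = l • ((U u - U v) - (u - v)) - e • (u - v) := by
      simp only [smul_sub]; abel
    rw [e1]
    refine (norm_sub_le _ _).trans ?_
    rw [norm_smul, norm_smul, Real.norm_eq_abs, Real.norm_eq_abs, abs_of_nonneg h0]
    have h2 : ‖(U u - U v) - (u - v)‖ ≤ 2 * ‖u - v‖ := by
      have := norm_sub_le (U u - U v) (u - v)
      linarith [hU u v]
    have h3 : l * ‖(U u - U v) - (u - v)‖ ≤ 1 * (2 * ‖u - v‖) :=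
      mul_le_mul h1 h2 (norm_nonneg _) zero_le_one
    linarith
  let lam' : ℝ → ℝ := fun t => if 0 ≤ t then lam t else 0
  have hlam'pos : ∀ t, 0 ≤ t → lam' t = lam t := fun t ht => if_pos ht
  have hlam' : ∀ t, 0 ≤ lam' t ∧ lam' t ≤ 1 := by
    intro t
    by_cases ht : 0 ≤ t
    · rw [hlam'pos t ht]; exact ⟨(hlam_range t ht).1.le, (hlam_range t ht).2⟩
    · simp [lam', ht]
  have hlam'm : Measurable lam' := Measurable.ite measurableSet_Ici hlam_meas measurable_const
  have hlam'i : ∀ b, IntervalIntegrable lam' volume 0 b := by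
    intro b
    apply (intervalIntegrable_const (c := (1:ℝ))).mono_fun' hlam'm.aestronglyMeasurable
    refine Eventually.of_forall fun t => ?_
    simp only [Real.norm_eq_abs]
    rw [abs_of_nonneg (hlam' t).1]; exact (hlam' t).2
  let f : ℝ → H → H := fun t w => lam' t • (T (P w) - w) - eps t • (w - y)
  have hI : ∀ x : ℝ → H, Continuous x → ∀ b,
      IntervalIntegrable (fun s => f s (x s)) volume 0 b := by
    intro x hx b
    exact ((hlam'i b).smul_continuousOn (g := fun s => T (P (x s)) - x s)
      (by fun_prop)).sub ((heps_int b).smul_continuousOn (g := fun s => x s - y) (by fun_prop))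
  obtain ⟨x, hxc, hxe⟩ := aux_exists_s5 k hk0 hk f
    (fun t => hLip (lam' t) (eps t) (fun w => T (P w)) (fun u v => (hT _ _).trans (hPn u v))
      (hlam' t).1 (hlam' t).2) hI x₀
  have hx0 : x 0 = x₀ := by simpa using hxe 0 le_rfl
  have hxD : ∀ t, 0 ≤ t → x t ∈ D := by
    intro t ht
    by_contra hnot
    obtain ⟨l, c, hl, hc⟩ := geometric_hahn_banach_closed_point hDconv hDcl hnot
    have := aux_nonpos (fun s => l (x s) - c) (fun s => l (f s (x s))) (by fun_prop)
      (by simp only [hx0]; linarith [hl x₀ hx₀])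
      (fun b => by
        have := hI x hxc b
        rw [intervalIntegrable_iff] at this ⊢
        exact l.integrable_comp this)
      (fun s hs => by
        rw [l.intervalIntegral_comp_comm (hI x hxc s), hx0, hxe s hs, map_add]
        ring_nf)
      (fun s hs hpos => by
        simp only [f, map_sub, map_smul, smul_eq_mul]
        have h1 := hl _ (hTD _ (hPD (x s)))
        have h2 := hl y hy
        have h3 := (hlam' s).1
        have h4 := heps_range s hs
        have h5 : lam' s * (l (T (P (x s))) - l (x s)) ≤ 0 :=
          mul_nonpos_of_nonneg_of_nonpos h3 (by linarith)
        have h6 : 0 ≤ eps s * (l (x s) - l y) := mul_nonneg h4 (by linarith)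
        linarith) t ht
    linarith
  let w : ℝ → H := fun t => if 0 ≤ t then x t else z
  have hwx : ∀ t, 0 ≤ t → w t = x t := fun t ht => if_pos ht
  have hfw : ∀ t, 0 ≤ t → lam t • (T (w t) - w t) - eps t • (w t - y) = f t (x t) := by
    intro t ht
    simp only [f]
    rw [hwx t ht, hPid _ (hxD t ht), hlam'pos t ht]
  have hw : IsStrongGlobalSolution (fun t w => lam t • (T w - w) - eps t • (w - y)) x₀ w := by
    refine ⟨hxc.continuousOn.congr fun t ht => hwx t ht, fun b => ?_, fun t ht => ?_⟩
    · rcases le_total 0 b with hb | hb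
      · refine (hI x hxc b).congr fun s hs => ?_
        rw [uIoc_of_le hb] at hs
        exact (hfw s hs.1.le).symm
      · have h1 : IntervalIntegrable (fun s => - (eps s • (z - y))) volume 0 b :=
          ((heps_int b).smul_continuousOn (g := fun _ => z - y) continuousOn_const).neg
        refine h1.congr_ae ?_
        have hne : ∀ᵐ s : ℝ, s ≠ 0 := by simp [ae_iff, measure_singleton]
        rw [uIoc_of_ge hb]
        filter_upwards [ae_restrict_of_ae hne, ae_restrict_mem measurableSet_Ioc] with s hs hs2
        have : ¬ (0 ≤ s) := fun h => hs (le_antisymm hs2.2 h)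
        simp [w, this, hz]
    · rw [hwx t ht, hxe t ht]
      congr 1
      apply intervalIntegral.integral_congr
      intro s hs
      rw [uIcc_of_le ht] at hs
      exact (hfw s hs.1).symm
  refine ⟨w, hw, fun t ht => by rw [hwx t ht]; exact hxD t ht, fun x' hx' t ht => ?_⟩
  exact aux_unique k hk0 hk _ (fun t ht => hLip (lam t) (eps t) T hT (hlam_range t ht).1.le
    (hlam_range t ht).2) x₀ w x' hw hx' t ht
end

section
/- Let H be a real Hilbert space, A : H → Set H maximally monotone, B : H → H β-cocoercive with β > 0 and Zer(A + B) nonempty, γ ∈ (0, 2β), and J : H → H a resolvent of γA. Let ε : [0, ∞) → [0, ∞) and λ : [0, ∞) → (0, (4β − γ)/(2β)] be Lebesgue measurable with ε locally integrable, and let x be the strong global solution of ẋ(t) = λ(t)·(J(x(t) − γ·B(x(t))) − x(t)) − ε(t)·x(t), x(0) = x₀ ∈ H. Assume: (i) ∫₀^∞ ε(t) dt = ∞; (ii) ∫₀^∞ λ(t) dt = ∞; (iii) ε and λ are locally absolutely continuous and ε(t)/λ(t) → 0 as t → ∞; (iv) ∫₀^∞ |(d/dt)(ε(t)/λ(t))|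 dt < ∞. Then x(t) converges strongly, as t → ∞, to P_{Zer(A+B)} 0, the minimum-norm zero of A + B. -/
open Filter MeasureTheory Set Topology
open scoped RealInnerProductSpace

variable {H : Type*} [NormedAddCommGroup H] [InnerProductSpace ℝ H] [CompleteSpace H]

/-- A continuous function with nonpositive upper right Dini derivative is nonincreasing. -/
lemma dini_le (f : ℝ → ℝ) (a : ℝ) (hf : ContinuousOn f (Ici a))
    (h : ∀ s, a ≤ s → ∀ η > 0, ∀ᶠ t in 𝓝[>] s, f t - f s ≤ η * (t - s)) :
    ∀ t, a ≤ t → f t ≤ f a := by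
  intro t ht
  have := image_le_of_liminf_slope_right_le_deriv_boundary (f := f) (a := a) (b := t)
    (hf.mono Icc_subset_Ici_self) (B := fun _ => f a) (B' := fun _ => 0) le_rfl
    continuousOn_const (fun x _ => hasDerivWithinAt_const _ _ _) ?_ (x := t) ⟨ht, le_rfl⟩
  · exact this
  · intro s hs r hr
    apply Eventually.frequently
    filter_upwards [h s hs.1 (r / 2) (by linarith), self_mem_nhdsWithin] with z hz hz'
    have hz'' : 0 < z - s := sub_pos.2 hz'
    rw [slope_def_field, div_lt_iff₀ hz'']
    nlinarith

/-- Right derivative gives a one-sided first order bound. -/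
lemma right_deriv_bound {F : Type*} [NormedAddCommGroup F] [NormedSpace ℝ F] {f : ℝ → F} {f' : F}
    {s : ℝ} (h : HasDerivWithinAt f f' (Ici s) s) {η : ℝ} (hη : 0 < η) :
    ∀ᶠ t in 𝓝[>] s, ‖f t - f s - (t - s) • f'‖ ≤ η * (t - s) := by
  have h1 := (hasDerivWithinAt_iff_isLittleO.1 h).bound hη
  have h2 := h1.filter_mono (nhdsWithin_mono s Ioi_subset_Ici_self)
  filter_upwards [h2, self_mem_nhdsWithin] with t ht ht'
  have hz'' : 0 < t - s := sub_pos.2 ht'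
  rwa [Real.norm_of_nonneg hz''.le] at ht

/-- Gronwall type lemma. -/
lemma gronwall_aux (u u' E eps : ℝ → ℝ) (a k c : ℝ)
    (hu : ContinuousOn u (Ici a)) (hE : ContinuousOn E (Ici a))
    (hu' : ∀ s, a ≤ s → HasDerivWithinAt u (u' s) (Ici s) s)
    (hE' : ∀ s, a ≤ s → HasDerivWithinAt E (eps s) (Ici s) s)
    (hle : ∀ s, a ≤ s → u' s ≤ k * eps s * (c - u s)) :
    ∀ t, a ≤ t → u t ≤ c + (u a - c) * Real.exp (-(k * (E t - E a))) := by
  intro t ht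
  have hder : ∀ s, a ≤ s → HasDerivWithinAt (fun t => (u t - c) * Real.exp (k * E t))
      (u' s * Real.exp (k * E s) + (u s - c) * (Real.exp (k * E s) * (k * eps s))) (Ici s) s := by
    intro s hs
    exact ((hu' s hs).sub_const c).mul ((hE' s hs).const_mul k).exp
  have := image_le_of_deriv_right_le_deriv_boundary
    (f := fun t => (u t - c) * Real.exp (k * E t)) (a := a) (b := t)
    (((hu.sub continuousOn_const).mul (Real.continuous_exp.comp_continuousOn
      (continuousOn_const.mul hE))).mono Icc_subset_Ici_self)
    (fun s hs => hder s hs.1)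
    (B := fun _ => (u a - c) * Real.exp (k * E a)) (B' := fun _ => 0) le_rfl
    continuousOn_const (fun x _ => hasDerivWithinAt_const _ _ _) ?_ (x := t) ⟨ht, le_rfl⟩
  · have h1 : Real.exp (-(k * (E t - E a))) = Real.exp (k * E a) * Real.exp (-(k * E t)) := by
      rw [← Real.exp_add]; ring_nf
    have h2 : Real.exp (k * E t) * Real.exp (-(k * E t)) = 1 := by
      rw [← Real.exp_add]; simp
    have h3 := mul_le_mul_of_nonneg_right this (Real.exp_pos (-(k * E t))).le
    rw [mul_assoc, h2, mul_assoc] at h3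
    rw [h1]; linarith
  · intro s hs
    have h1 := hle s hs.1
    have h2 := Real.exp_pos (k * E s)
    have h3 := mul_le_mul_of_nonneg_left h1 h2.le
    nlinarith

/-- Nonexpansive: weak cluster point of an asymptotically regular bounded family. -/
lemma demiclosed_aux (N : H → H) (hN : ∀ y z, ‖N y - N z‖ ≤ ‖y - z‖) (x : ℝ → H) (C : ℝ)
    (hC : ∀ t, 0 ≤ t → ‖x t‖ ≤ C)
    (hreg : Tendsto (fun t => ‖N (x t) - x t‖) atTop (𝓝 0)) (p : H)
    (hp : ∀ z, N z = z → 0 ≤ ⟪p, z - p⟫) (c : ℝ) (hc : 0 < c) :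
    ∀ᶠ t in atTop, -⟪p, x t - p⟫ ≤ c := by
  by_contra hcon
  have hfr : ∃ᶠ t in atTop, ¬ (-⟪p, x t - p⟫ ≤ c) :=
    not_eventually.1 hcon
  have : NeBot (atTop ⊓ 𝓟 {t : ℝ | ¬ (-⟪p, x t - p⟫ ≤ c)}) := frequently_iff_neBot.1 hfr
  set U := Ultrafilter.of (atTop ⊓ 𝓟 {t : ℝ | ¬ (-⟪p, x t - p⟫ ≤ c)}) with hU
  have hU1 : (U : Filter ℝ) ≤ atTop := (Ultrafilter.of_le _).trans inf_le_left
  have hU2 : ∀ᶠ t in (U : Filter ℝ), ¬ (-⟪p, x t - p⟫ ≤ c) := by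
    have : (U : Filter ℝ) ≤ 𝓟 {t : ℝ | ¬ (-⟪p, x t - p⟫ ≤ c)} :=
      (Ultrafilter.of_le _).trans inf_le_right
    exact le_principal_iff.1 this
  have hU0 : ∀ᶠ t in (U : Filter ℝ), 0 ≤ t := hU1 (eventually_ge_atTop 0)
  let D : ℝ → WeakDual ℝ H := fun t => StrongDual.toWeakDual (InnerProductSpace.toDual ℝ H (x t))
  obtain ⟨ℓ, -, hℓ⟩ := (WeakDual.isCompact_closedBall (𝕜 := ℝ) (E := H) 0 C).ultrafilter_le_nhds
    (U.map D) (by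
      rw [le_principal_iff]
      change ∀ᶠ t in (U : Filter ℝ), _
      filter_upwards [hU0] with t ht
      have : ‖InnerProductSpace.toDual ℝ H (x t)‖ ≤ C := by
        rw [LinearIsometryEquiv.norm_map]; exact hC t ht
      simpa [D] using this)
  set z : H := (InnerProductSpace.toDual ℝ H).symm (WeakDual.toStrongDual ℓ) with hz
  have hw : ∀ y : H, Tendsto (fun t => ⟪x t, y⟫) U (𝓝 ⟪z, y⟫) := by
    intro y
    have h1 : Tendsto (fun d : WeakDual ℝ H => d y) (𝓝 ℓ) (𝓝 (ℓ y)) :=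
      (WeakDual.eval_continuous y).tendsto ℓ
    have h2 : Tendsto D U (𝓝 ℓ) := hℓ
    have h3 := h1.comp h2
    have h4 : ℓ y = ⟪z, y⟫ := by
      rw [hz, InnerProductSpace.toDual_symm_apply]; rfl
    rw [← h4]
    exact h3
  have hNz : N z = z := by
    have key : ∀ᶠ t in (U : Filter ℝ), ‖z - N z‖ ^ 2 ≤
        -2 * (⟪x t, z - N z⟫ - ⟪z, z - N z⟫) +
          (‖N (x t) - x t‖ ^ 2 + 2 * ‖N (x t) - x t‖ * (C + ‖z‖)) := by
      filter_upwards [hU0] with t ht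
      have h1 : ‖x t - N z‖ ≤ ‖N (x t) - x t‖ + ‖x t - z‖ := by
        calc ‖x t - N z‖ = ‖-(N (x t) - x t) + (N (x t) - N z)‖ := by congr 1; abel
          _ ≤ _ := (norm_add_le _ _).trans (by rw [norm_neg]; gcongr; exact hN _ _)
      have h2 : ‖x t - N z‖ ^ 2 = ‖x t - z‖ ^ 2 + 2 * ⟪x t - z, z - N z⟫ + ‖z - N z‖ ^ 2 := by
        rw [← norm_add_sq_real]; congr 2; abel
      have h3 : ‖x t - z‖ ≤ C + ‖z‖ := (norm_sub_le _ _).trans (by gcongr; exact hC t ht)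
      rw [inner_sub_left] at h2
      have h4 := pow_le_pow_left₀ (norm_nonneg _) h1 2
      nlinarith [norm_nonneg (N (x t) - x t)]
    have hr := hreg.mono_left hU1
    have hlim : Tendsto (fun t => -2 * (⟪x t, z - N z⟫ - ⟪z, z - N z⟫) +
          (‖N (x t) - x t‖ ^ 2 + 2 * ‖N (x t) - x t‖ * (C + ‖z‖))) U
          (𝓝 (-2 * (⟪z, z - N z⟫ - ⟪z, z - N z⟫) + (0 ^ 2 + 2 * 0 * (C + ‖z‖)))) :=
      (((hw _).sub_const _).const_mul _).add ((hr.pow 2).add ((hr.const_mul 2).mul_const _))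
    have := ge_of_tendsto hlim key
    have h0 : ‖z - N z‖ ^ 2 = 0 := le_antisymm (by simpa using this) (by positivity)
    have h0' : z - N z = 0 := by simpa using h0
    exact (sub_eq_zero.1 h0').symm
  have h1 := hp z hNz
  have h2 : ∀ᶠ t in (U : Filter ℝ), ⟪x t, p⟫ ≤ ⟪p, p⟫ - c := by
    filter_upwards [hU2] with t ht
    rw [inner_sub_right, real_inner_comm] at ht
    linarith
  have h3 := le_of_tendsto (hw p) h2
  rw [inner_sub_right, real_inner_comm] at h1
  linarith

lemma fix_convex (N : H → H) (hN : ∀ y z, ‖N y - N z‖ ≤ ‖y - z‖) :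
    Convex ℝ {z | N z = z} := by
  intro y hy w hw a b ha hb hab
  change N y = y at hy
  change N w = w at hw
  change N (a • y + b • w) = a • y + b • w
  set z := a • y + b • w with hz
  have e : ∀ q : H, a * ‖q - y‖ ^ 2 + b * ‖q - w‖ ^ 2 = ‖q - z‖ ^ 2 + a * b * ‖y - w‖ ^ 2 := by
    intro q
    obtain rfl : a = 1 - b := by linarith
    have : q - z = (q - y) + b • (y - w) := by rw [hz]; module
    have h2 : q - w = (q - y) + (y - w) := by abel
    rw [this, h2, norm_add_sq_real, norm_add_sq_real, norm_smul, inner_smul_right, mul_pow,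
      Real.norm_eq_abs, sq_abs]
    ring
  have h1 := e (N z)
  have h2 := e z
  have h3 := hN z y
  have h4 := hN z w
  rw [hy] at h3
  rw [hw] at h4
  have h3' := mul_le_mul_of_nonneg_left (pow_le_pow_left₀ (norm_nonneg _) h3 2) ha
  have h4' := mul_le_mul_of_nonneg_left (pow_le_pow_left₀ (norm_nonneg _) h4 2) hb
  have h5 : ‖z - z‖ = 0 := by simp
  rw [h5] at h2
  have h0 : ‖N z - z‖ ^ 2 = 0 := le_antisymm (by nlinarith) (by positivity)
  have h0' : N z - z = 0 := by simpa using h0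
  exact sub_eq_zero.1 h0'

/-- Existence of the minimum norm fixed point. -/
lemma exists_min_norm (N : H → H) (hN : ∀ y z, ‖N y - N z‖ ≤ ‖y - z‖) (hne : ∃ z, N z = z) :
    ∃ p, N p = p ∧ (∀ z, N z = z → 0 ≤ ⟪p, z - p⟫) := by
  have hcont : Continuous N := by
    have : LipschitzWith 1 N := LipschitzWith.of_dist_le_mul (by
      intro y z; simpa [dist_eq_norm] using hN y z)
    exact this.continuous
  have hcl : IsClosed {z | N z = z} := isClosed_eq hcont continuous_id
  have hcv := fix_convex N hN
  obtain ⟨p, hp, hp'⟩ := exists_norm_eq_iInf_of_complete_convex (K := {z | N z = z}) hne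
    hcl.isComplete hcv 0
  refine ⟨p, hp, fun z hz => ?_⟩
  have := (norm_eq_iInf_iff_real_inner_le_zero hcv hp).1 hp' z hz
  simpa using this

/-- The residual estimate. -/
lemma residual_aux (N : H → H) (hN : ∀ y z, ‖N y - N z‖ ≤ ‖y - z‖)
    (mu eps r V E : ℝ → ℝ) (x : ℝ → H) (C : ℝ)
    (hmu : ∀ t, 0 ≤ t → 0 < mu t) (hr0 : ∀ t, 0 ≤ t → 0 ≤ r t)
    (hre : ∀ t, 0 ≤ t → mu t * r t = eps t)
    (hrc : ContinuousOn r (Ici 0)) (hxc : ContinuousOn x (Ici 0))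
    (hEc : ContinuousOn E (Ici 0)) (hVc : ContinuousOn V (Ici 0))
    (hx' : ∀ s, 0 ≤ s → HasDerivWithinAt x (mu s • (N (x s) - x s - r s • x s)) (Ici s) s)
    (hE' : ∀ s, 0 ≤ s → HasDerivWithinAt E (eps s) (Ici s) s)
    (hV : ∀ s t, 0 ≤ s → s ≤ t → |r t - r s| ≤ V t - V s)
    (hC : ∀ t, 0 ≤ t → ‖x t‖ ≤ C)
    (c T : ℝ) (hc : 0 ≤ c) (hT : 0 ≤ T)
    (hcv : ∀ s, T ≤ s → c ≤ ‖N (x s) - x s - r s • x s‖) :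
    ∀ t, T ≤ t → ‖N (x t) - x t - r t • x t‖ + c * E t ≤
      ‖N (x T) - x T - r T • x T‖ + C * (V t - V T) + c * E T := by
  have hNc : Continuous N := by
    have : LipschitzWith 1 N := LipschitzWith.of_dist_le_mul (by
      intro y z; simpa [dist_eq_norm] using hN y z)
    exact this.continuous
  set v : ℝ → H := fun t => N (x t) - x t - r t • x t with hv
  have hvc : ContinuousOn v (Ici 0) :=
    ((hNc.comp_continuousOn hxc).sub hxc).sub (hrc.smul hxc)
  have main := dini_le (fun t => ‖v t‖ + c * E t - C * V t) T
    (((hvc.norm.add (continuousOn_const.mul hEc)).sub (continuousOn_const.mul hVc)).mono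
      (Ici_subset_Ici.2 hT)) ?_
  · intro t ht
    have := main t ht
    change ‖v t‖ + c * E t ≤ ‖v T‖ + C * (V t - V T) + c * E T
    linarith
  intro s hs η hη
  have hs0 : 0 ≤ s := hT.trans hs
  have hr := hr0 s hs0
  have hm := hmu s hs0
  set η₁ := η / (2 * (2 + r s)) with hη₁
  have hη₁p : 0 < η₁ := by positivity
  set η₂ := η / (2 * (1 + c)) with hη₂
  have hη₂p : 0 < η₂ := by positivity
  have b1 := right_deriv_bound (hx' s hs0) hη₁p
  have b2 := right_deriv_bound (hE' s hs0) hη₂p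
  have b3 : ∀ᶠ t in 𝓝[>] s, (1 + r s) * mu s * (t - s) ≤ 1 := by
    have : Tendsto (fun t => (1 + r s) * mu s * (t - s)) (𝓝 s) (𝓝 ((1 + r s) * mu s * (s - s))) :=
      (Continuous.tendsto (by fun_prop) s)
    rw [sub_self, mul_zero] at this
    have h2 := this.eventually (eventually_le_nhds (show (0:ℝ) < 1 by norm_num))
    exact h2.filter_mono nhdsWithin_le_nhds
  filter_upwards [b1, b2, b3, self_mem_nhdsWithin] with t h1 h2 h3 h4
  have h4 : 0 < t - s := sub_pos.2 h4
  have hst : s ≤ t := by linarith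
  have ht0 : 0 ≤ t := hs0.trans hst
  set w := x t - x s - (t - s) • (mu s • v s) with hw
  have h1 : ‖w‖ ≤ η₁ * (t - s) := h1
  have e1 : x t - x s = ((t - s) * mu s) • v s + w := by rw [hw, smul_smul]; abel
  have p1 : ‖x t - x s‖ ≤ (t - s) * mu s * ‖v s‖ + η₁ * (t - s) := by
    rw [e1]
    refine (norm_add_le _ _).trans (add_le_add ?_ h1)
    rw [norm_smul, Real.norm_of_nonneg (by positivity)]
  have e2 : v s - (1 + r s) • (x t - x s) =
      (1 - (1 + r s) * mu s * (t - s)) • v s - (1 + r s) • w := by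
    rw [e1]; module
  have p2 : ‖v s - (1 + r s) • (x t - x s)‖ ≤
      (1 - (1 + r s) * mu s * (t - s)) * ‖v s‖ + (1 + r s) * (η₁ * (t - s)) := by
    rw [e2]
    refine (norm_sub_le _ _).trans (add_le_add ?_ ?_)
    · rw [norm_smul, Real.norm_of_nonneg (by linarith)]
    · rw [norm_smul, Real.norm_of_nonneg (by linarith)]
      gcongr
  have p3 : ‖(r t - r s) • x t‖ ≤ C * (V t - V s) := by
    rw [norm_smul, mul_comm, Real.norm_eq_abs]
    have hC0 : 0 ≤ C := (norm_nonneg _).trans (hC t ht0)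
    exact mul_le_mul (hC t ht0) (hV s t hs0 hst) (abs_nonneg _) hC0
  have e3 : v t = (N (x t) - N (x s)) + (v s - (1 + r s) • (x t - x s)) - (r t - r s) • x t := by
    simp only [hv]; module
  have p4 : ‖v t‖ ≤ ‖x t - x s‖ + ‖v s - (1 + r s) • (x t - x s)‖ + ‖(r t - r s) • x t‖ := by
    rw [e3]
    refine (norm_sub_le _ _).trans (add_le_add ((norm_add_le _ _).trans ?_) le_rfl)
    exact add_le_add (hN _ _) le_rfl
  have p5 : ‖v t‖ ≤ ‖v s‖ - eps s * (t - s) * ‖v s‖ + C * (V t - V s) + η / 2 * (t - s) := by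
    have q : (2 + r s) * η₁ = η / 2 := by rw [hη₁]; field_simp
    rw [← q, ← hre s hs0]
    nlinarith
  have p6 : E t - E s ≤ eps s * (t - s) + η₂ * (t - s) := by
    have := (abs_le.1 h2).2
    simp only [smul_eq_mul] at this
    linarith
  have p7 : c * η₂ ≤ η / 2 := by
    rw [hη₂]
    rw [mul_div_assoc', div_le_div_iff₀ (by positivity) (by positivity)]
    nlinarith
  have he : 0 ≤ eps s := by rw [← hre s hs0]; positivity
  have p8 : eps s * (t - s) * c ≤ eps s * (t - s) * ‖v s‖ :=
    mul_le_mul_of_nonneg_left (hcv s hs) (by positivity)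
  have p9 := mul_le_mul_of_nonneg_left p6 hc
  have p10 := mul_le_mul_of_nonneg_right p7 h4.le
  nlinarith

/-- The abstract convergence theorem. -/
lemma abstract_conv (N : H → H) (hN : ∀ y z, ‖N y - N z‖ ≤ ‖y - z‖)
    (mu eps r V E : ℝ → ℝ) (x : ℝ → H) (L : ℝ)
    (hmu : ∀ t, 0 ≤ t → 0 < mu t) (hr0 : ∀ t, 0 ≤ t → 0 ≤ r t)
    (hre : ∀ t, 0 ≤ t → mu t * r t = eps t)
    (hrc : ContinuousOn r (Ici 0)) (hxc : ContinuousOn x (Ici 0))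
    (hEc : ContinuousOn E (Ici 0)) (hVc : ContinuousOn V (Ici 0))
    (hx' : ∀ s, 0 ≤ s → HasDerivWithinAt x (mu s • (N (x s) - x s - r s • x s)) (Ici s) s)
    (hE' : ∀ s, 0 ≤ s → HasDerivWithinAt E (eps s) (Ici s) s)
    (hV : ∀ s t, 0 ≤ s → s ≤ t → |r t - r s| ≤ V t - V s)
    (hVlim : Tendsto V atTop (𝓝 L))
    (hElim : Tendsto E atTop atTop)
    (hrlim : Tendsto r atTop (𝓝 0))
    (p : H) (hp : N p = p) (hpz : ∀ z, N z = z → 0 ≤ ⟪p, z - p⟫) :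
    Tendsto x atTop (𝓝 p) := by
  have heps : ∀ t, 0 ≤ t → 0 ≤ eps t := fun t ht => by
    rw [← hre t ht]; exact mul_nonneg (hmu t ht).le (hr0 t ht)
  -- derivative of the squared distance
  set u : ℝ → ℝ := fun t => ‖x t - p‖ ^ 2 with hu
  set u' : ℝ → ℝ := fun t => 2 * ⟪x t - p, mu t • (N (x t) - x t - r t • x t)⟫ with hu'
  have huc : ContinuousOn u (Ici 0) := ((hxc.sub continuousOn_const).norm).pow 2
  have hud : ∀ s, 0 ≤ s → HasDerivWithinAt u (u' s) (Ici s) s := fun s hs =>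
    ((hx' s hs).sub_const p).norm_sq
  have hule : ∀ s, 0 ≤ s → u' s ≤ 2 * eps s * (-⟪p, x s - p⟫ - u s) := by
    intro s hs
    have h1 : ⟪x s - p, N (x s) - x s⟫ ≤ 0 := by
      have h2 := hN (x s) p
      rw [hp] at h2
      have h3 : N (x s) - x s = (N (x s) - p) - (x s - p) := by abel
      rw [h3, inner_sub_right, real_inner_self_eq_norm_sq]
      have h4 := real_inner_le_norm (x s - p) (N (x s) - p)
      nlinarith [norm_nonneg (x s - p)]
    have h5 : ⟪x s - p, x s⟫ = u s + ⟪p, x s - p⟫ := by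
      simp only [hu]
      rw [← real_inner_self_eq_norm_sq, real_inner_comm (x s - p) p, ← inner_add_right]
      simp
    simp only [hu', inner_smul_right, inner_sub_right (x s - p) (N (x s) - x s), h5]
    rw [← hre s hs]
    nlinarith [mul_nonpos_of_nonneg_of_nonpos (hmu s hs).le h1]
  have hEmono : ∀ t, 0 ≤ t → E 0 ≤ E t := by
    intro t ht
    have := image_le_of_deriv_right_le_deriv_boundary (f := fun t => - E t) (a := 0) (b := t)
      (hEc.neg.mono Icc_subset_Ici_self) (fun s hs => (hE' s hs.1).neg)
      (B := fun _ => - E 0) (B' := fun _ => 0) le_rfl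
      continuousOn_const (fun x _ => hasDerivWithinAt_const _ _ _)
      (fun s hs => by have := heps s hs.1; simpa using this) (x := t) ⟨ht, le_rfl⟩
    linarith
  -- boundedness
  obtain ⟨C, hC⟩ : ∃ C, ∀ t, 0 ≤ t → ‖x t‖ ≤ C := by
    refine ⟨‖p‖ + (1 + (‖p‖ ^ 2 + u 0)), fun t ht => ?_⟩
    have h1 := gronwall_aux u u' E eps 0 1 (‖p‖ ^ 2) huc hEc hud hE' (by
      intro s hs
      have h2 := hule s hs
      have h3 : -⟪p, x s - p⟫ ≤ ‖p‖ * ‖x s - p‖ := by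
        have := abs_real_inner_le_norm p (x s - p)
        exact (neg_le_abs _).trans this
      have h4 : 2 * (-⟪p, x s - p⟫ - u s) ≤ ‖p‖ ^ 2 - u s := by
        simp only [hu]
        nlinarith [sq_nonneg (‖p‖ - ‖x s - p‖)]
      nlinarith [mul_le_mul_of_nonneg_left h4 (heps s hs)]) t ht
    have h2 : Real.exp (-(1 * (E t - E 0))) ≤ 1 := by
      rw [Real.exp_le_one_iff]; linarith [hEmono t ht]
    have h3 := Real.exp_pos (-(1 * (E t - E 0)))
    have h4 : 0 ≤ u 0 := by simp only [hu]; positivity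
    have h5 : u t ≤ ‖p‖ ^ 2 + u 0 := by nlinarith [sq_nonneg ‖p‖]
    have h6 : ‖x t - p‖ ≤ 1 + (‖p‖ ^ 2 + u 0) := by
      have : ‖x t - p‖ ^ 2 ≤ ‖p‖ ^ 2 + u 0 := h5
      nlinarith [sq_nonneg (‖x t - p‖ - 1), norm_nonneg (x t - p)]
    calc ‖x t‖ = ‖p + (x t - p)‖ := by congr 1; abel
      _ ≤ _ := (norm_add_le _ _).trans (by gcongr)
  -- residual
  set v : ℝ → H := fun t => N (x t) - x t - r t • x t with hv
  have hC0 : 0 ≤ C := (norm_nonneg _).trans (hC 0 le_rfl)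
  have hres : ∀ c T : ℝ, 0 ≤ c → 0 ≤ T → (∀ s, T ≤ s → c ≤ ‖v s‖) → ∀ t, T ≤ t →
      ‖v t‖ + c * E t ≤ ‖v T‖ + C * (V t - V T) + c * E T :=
    fun c T hc hT hcv => residual_aux N hN mu eps r V E x C hmu hr0 hre hrc hxc hEc hVc hx' hE' hV
      hC c T hc hT hcv
  have hVle : ∀ t, 0 ≤ t → V t ≤ L := by
    intro t ht
    refine ge_of_tendsto hVlim ?_
    filter_upwards [eventually_ge_atTop t] with s hs
    have := (abs_nonneg _).trans (hV t s ht hs)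
    linarith
  have hvlim : Tendsto (fun t => ‖v t‖) atTop (𝓝 0) := by
    rw [Metric.tendsto_atTop]
    intro η hη
    have hVc' : ∀ᶠ T in atTop, C * (L - V T) < η / 2 := by
      have : Tendsto (fun T => C * (L - V T)) atTop (𝓝 (C * (L - L))) :=
        (tendsto_const_nhds.sub hVlim).const_mul C
      rw [sub_self, mul_zero] at this
      exact this.eventually (eventually_lt_nhds (by linarith))
    obtain ⟨T₀, hT₀⟩ := eventually_atTop.1 (hVc'.and (eventually_ge_atTop 0))
    have hex : ∃ T, T₀ ≤ T ∧ ‖v T‖ < η / 2 := by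
      by_contra hcon
      push Not at hcon
      have h0 := (hT₀ T₀ le_rfl).2
      have h1 := hres (η / 2) T₀ (by linarith) h0 hcon
      obtain ⟨t, ht1, ht2⟩ := ((hElim.eventually_gt_atTop
        ((‖v T₀‖ + C * (L - V T₀) + η / 2 * E T₀) / (η / 2))).and (eventually_ge_atTop T₀)).exists
      have h2 := h1 t ht2
      rw [div_lt_iff₀ (by linarith)] at ht1
      have h3 := mul_le_mul_of_nonneg_left (hVle t (h0.trans ht2)) hC0
      nlinarith [norm_nonneg (v t)]
    obtain ⟨T, hT1, hT2⟩ := hex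
    refine ⟨T, fun t ht => ?_⟩
    obtain ⟨h3, h4⟩ := hT₀ T hT1
    have h5 := hres 0 T le_rfl h4 (fun s _ => norm_nonneg _) t ht
    have h6 := mul_le_mul_of_nonneg_left (hVle t (h4.trans ht)) hC0
    rw [Real.dist_eq, sub_zero, abs_of_nonneg (norm_nonneg _)]
    nlinarith
  have hreg : Tendsto (fun t => ‖N (x t) - x t‖) atTop (𝓝 0) := by
    have h1 : Tendsto (fun t => ‖v t‖ + r t * C) atTop (𝓝 (0 + 0 * C)) :=
      hvlim.add (hrlim.mul_const C)
    rw [zero_mul, add_zero] at h1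
    refine squeeze_zero' (Eventually.of_forall fun t => norm_nonneg _) ?_ h1
    filter_upwards [eventually_ge_atTop 0] with t ht
    have : N (x t) - x t = v t + r t • x t := by simp only [hv]; abel
    rw [this]
    refine (norm_add_le _ _).trans (add_le_add le_rfl ?_)
    rw [norm_smul, Real.norm_of_nonneg (hr0 t ht)]
    exact mul_le_mul_of_nonneg_left (hC t ht) (hr0 t ht)
  -- conclusion
  have hulim : Tendsto u atTop (𝓝 0) := by
    rw [Metric.tendsto_atTop]
    intro η hη
    obtain ⟨T, hT⟩ := eventually_atTop.1
      ((demiclosed_aux N hN x C hC hreg p hpz (η / 2) (by linarith)).and (eventually_ge_atTop 0))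
    have hT0 : 0 ≤ T := (hT T le_rfl).2
    have h1 := gronwall_aux u u' E eps T 2 (η / 2) (huc.mono (Ici_subset_Ici.2 hT0))
      (hEc.mono (Ici_subset_Ici.2 hT0)) (fun s hs => hud s (hT0.trans hs))
      (fun s hs => hE' s (hT0.trans hs)) (by
        intro s hs
        refine (hule s (hT0.trans hs)).trans ?_
        have := heps s (hT0.trans hs)
        have h3 := (hT s hs).1
        gcongr)
    have h2 : Tendsto (fun t => η / 2 + (u T - η / 2) * Real.exp (-(2 * (E t - E T)))) atTop
        (𝓝 (η / 2 + (u T - η / 2) * 0)) := by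
      refine tendsto_const_nhds.add (Tendsto.const_mul _ ?_)
      refine Real.tendsto_exp_neg_atTop_nhds_zero.comp ?_
      exact Tendsto.const_mul_atTop (by norm_num) (tendsto_atTop_add_const_right _ _ hElim)
    have h3 := h2.eventually (eventually_lt_nhds (show η / 2 + (u T - η / 2) * 0 < η by linarith))
    obtain ⟨S, hS⟩ := eventually_atTop.1 (h3.and (eventually_ge_atTop T))
    refine ⟨S, fun t ht => ?_⟩
    have h4 := hS t ht
    have h5 : 0 ≤ u t := by simp only [hu]; positivity
    rw [Real.dist_eq, sub_zero, abs_of_nonneg h5]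
    exact (h1 t h4.2).trans_lt h4.1
  rw [tendsto_iff_norm_sub_tendsto_zero]
  have := hulim.sqrt
  simpa [hu, Real.sqrt_sq (norm_nonneg _)] using this

lemma ac_continuousOn (g gd : ℝ → ℝ) (hg : ∀ b : ℝ, IntervalIntegrable gd volume 0 b)
    (h : ∀ t : ℝ, 0 ≤ t → g t = g 0 + ∫ s in (0:ℝ)..t, gd s) : ContinuousOn g (Ici 0) := by
  have h1 : Continuous (fun t => g 0 + ∫ s in (0:ℝ)..t, gd s) :=
    continuous_const.add (intervalIntegral.continuous_primitive
      (fun a b => (hg a).symm.trans (hg b)) 0)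
  exact h1.continuousOn.congr (fun t ht => h t ht)

lemma primitive_right_deriv {F : Type*} [NormedAddCommGroup F] [NormedSpace ℝ F] [CompleteSpace F]
    (f : ℝ → F) (hf : ContinuousOn f (Ici 0)) (s : ℝ) (hs : 0 ≤ s) :
    HasDerivWithinAt (fun u => ∫ y in (0:ℝ)..u, f y) (f s) (Ici s) s := by
  set f' : ℝ → F := fun y => f (max y 0) with hf'
  have hc : Continuous f' := by
    apply hf.comp_continuous (by fun_prop)
    intro y
    exact mem_Ici.2 (le_max_right y 0)
  have h1 : HasDerivAt (fun u => ∫ y in (0:ℝ)..u, f' y) (f' s) s :=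
    intervalIntegral.integral_hasDerivAt_right (hc.intervalIntegrable _ _)
      (hc.stronglyMeasurableAtFilter _ _) hc.continuousAt
  have h2 : f' s = f s := by simp [hf', max_eq_left hs]
  have h3 : ∀ u ∈ Ici s, (∫ y in (0:ℝ)..u, f y) = ∫ y in (0:ℝ)..u, f' y := by
    intro u hu
    apply intervalIntegral.integral_congr
    intro y hy
    rw [uIcc_of_le (hs.trans hu)] at hy
    simp [hf', max_eq_left hy.1]
  rw [← h2]
  exact h1.hasDerivWithinAt.congr h3 (h3 s self_mem_Ici)

lemma primitive_atTop (eps : ℝ → ℝ) (h0 : ∀ t : ℝ, 0 ≤ t → 0 ≤ eps t)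
    (hint : ∀ b : ℝ, IntervalIntegrable eps volume 0 b)
    (hi : ∫⁻ t in Set.Ioi (0:ℝ), ENNReal.ofReal (eps t) = ⊤) :
    Tendsto (fun t => ∫ s in (0:ℝ)..t, eps s) atTop atTop := by
  have hmono : ∀ s t : ℝ, 0 ≤ s → s ≤ t → ∫ y in (0:ℝ)..s, eps y ≤ ∫ y in (0:ℝ)..t, eps y := by
    intro s t hs hst
    rw [← sub_nonneg, intervalIntegral.integral_interval_sub_left (hint t) (hint s)]
    exact intervalIntegral.integral_nonneg hst (fun u hu => h0 u (hs.trans hu.1))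
  rw [tendsto_atTop]
  intro b
  by_contra hcon
  have hb : ∀ t : ℝ, 0 ≤ t → ∫ y in (0:ℝ)..t, eps y ≤ b := by
    intro t ht
    by_contra hlt
    push Not at hlt
    apply hcon
    filter_upwards [eventually_ge_atTop t] with s hs
    exact hlt.le.trans (hmono t s ht hs)
  have hI : IntegrableOn eps (Ioi 0) := by
    refine integrableOn_Ioi_of_intervalIntegral_norm_bounded (l := atTop) (b := fun n : ℕ => (n : ℝ))
      b 0 (fun n => ?_) tendsto_natCast_atTop_atTop ?_
    · exact (intervalIntegrable_iff_integrableOn_Ioc_of_le n.cast_nonneg).1 (hint n)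
    · filter_upwards with n
      have : ∫ y in (0:ℝ)..n, ‖eps y‖ = ∫ y in (0:ℝ)..n, eps y := by
        apply intervalIntegral.integral_congr
        intro y hy
        rw [uIcc_of_le n.cast_nonneg] at hy
        exact Real.norm_of_nonneg (h0 y hy.1)
      rw [this]
      exact hb n n.cast_nonneg
  have h1 := hI.lintegral_lt_top
  rw [hi] at h1
  exact lt_irrefl _ h1

lemma variation_aux (eps lam : ℝ → ℝ) (hlam : ∀ t : ℝ, 0 ≤ t → 0 < lam t)
    (heps_int : ∀ b : ℝ, IntervalIntegrable eps volume 0 b)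
    (hi : ∫⁻ t in Set.Ioi (0:ℝ), ENNReal.ofReal (eps t) = ⊤)
    (hratio : Tendsto (fun t => eps t / lam t) atTop (𝓝 (0:ℝ)))
    (rd : ℝ → ℝ)
    (h1 : ∀ t : ℝ, 0 ≤ t → eps t / lam t = eps 0 / lam 0 + ∫ s in (0:ℝ)..t, rd s)
    (h2 : ∫⁻ t in Set.Ioi (0:ℝ), ENNReal.ofReal |rd t| < ⊤) :
    ∃ (V : ℝ → ℝ) (L : ℝ), ContinuousOn V (Ici 0) ∧ Tendsto V atTop (𝓝 L) ∧
      ∀ s t, 0 ≤ s → s ≤ t → |eps t / lam t - eps s / lam s| ≤ V t - V s := by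
  by_cases hm : AEStronglyMeasurable rd (volume.restrict (Ioi (0:ℝ)))
  · have hI : IntegrableOn rd (Ioi 0) := by
      refine ⟨hm, ?_⟩
      rw [hasFiniteIntegral_iff_norm]
      exact h2
    have hI' : IntegrableOn (fun t => |rd t|) (Ioi 0) := hI.abs
    have hii : ∀ {f : ℝ → ℝ}, IntegrableOn f (Ioi 0) → ∀ t, 0 ≤ t →
        IntervalIntegrable f volume 0 t := by
      intro f hf t ht
      exact (intervalIntegrable_iff_integrableOn_Ioc_of_le ht).2 (hf.mono_set Ioc_subset_Ioi_self)
    refine ⟨fun t => ∫ s in (0:ℝ)..t, |rd s|, ∫ s in Ioi (0:ℝ), |rd s|, ?_, ?_, ?_⟩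
    · intro t ht
      have hc := intervalIntegral.continuousOn_primitive_interval (a := 0) (b := t + 1)
        (μ := volume) (f := fun s => |rd s|) (by
          have h0 : (0:ℝ) ≤ t + 1 := by have : (0:ℝ) ≤ t := ht; linarith
          rw [uIcc_of_le h0, integrableOn_Icc_iff_integrableOn_Ioc]
          exact hI'.mono_set Ioc_subset_Ioi_self)
      have ht' : (0:ℝ) ≤ t := ht
      rw [uIcc_of_le (by linarith)] at hc
      refine (hc t ⟨ht, by linarith⟩).mono_of_mem_nhdsWithin ?_
      rw [mem_nhdsWithin]
      refine ⟨Iio (t + 1), isOpen_Iio, by simp, ?_⟩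
      rintro y ⟨hy1, hy2⟩
      exact ⟨hy2, le_of_lt hy1⟩
    · exact intervalIntegral_tendsto_integral_Ioi 0 hI' tendsto_id
    · intro s t hs hst
      have ht := hs.trans hst
      rw [h1 t ht, h1 s hs, add_sub_add_left_eq_sub,
        intervalIntegral.integral_interval_sub_left (hii hI t ht) (hii hI s hs),
        intervalIntegral.integral_interval_sub_left (hii hI' t ht) (hii hI' s hs)]
      exact intervalIntegral.abs_integral_le_integral_abs hst
  · exfalso
    have hU : Ioi (0:ℝ) = ⋃ n : ℕ, Ioc (0:ℝ) n := by
      ext y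
      simp only [mem_Ioi, mem_iUnion, mem_Ioc, exists_and_left]
      exact ⟨fun h => ⟨h, exists_nat_ge y⟩, fun h => h.1⟩
    rw [hU, aestronglyMeasurable_iUnion_iff] at hm
    push Not at hm
    obtain ⟨n, hn⟩ := hm
    have hc : ∀ t : ℝ, (n : ℝ) ≤ t → eps t / lam t = eps 0 / lam 0 := by
      intro t ht
      have ht0 : (0:ℝ) ≤ t := n.cast_nonneg.trans ht
      rw [h1 t ht0, intervalIntegral.integral_undef, add_zero]
      intro hcon
      rw [intervalIntegrable_iff_integrableOn_Ioc_of_le ht0] at hcon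
      exact hn (hcon.mono_set (Ioc_subset_Ioc_right ht)).aestronglyMeasurable
    have h3 : Tendsto (fun t => eps t / lam t) atTop (𝓝 (eps 0 / lam 0)) :=
      tendsto_const_nhds.congr' (by
        filter_upwards [eventually_ge_atTop (n : ℝ)] with t ht
        exact (hc t ht).symm)
    have h4 : eps 0 / lam 0 = 0 := tendsto_nhds_unique h3 hratio
    have h5 : ∀ t : ℝ, (n : ℝ) ≤ t → eps t = 0 := by
      intro t ht
      have h6 := hc t ht
      rw [h4, div_eq_zero_iff] at h6
      exact h6.resolve_right (hlam t (n.cast_nonneg.trans ht)).ne'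
    have h6 : IntegrableOn eps (Ioi 0) := by
      rw [← Ioc_union_Ioi_eq_Ioi (n.cast_nonneg : (0:ℝ) ≤ n)]
      refine IntegrableOn.union
        ((intervalIntegrable_iff_integrableOn_Ioc_of_le n.cast_nonneg).1 (heps_int n)) ?_
      refine (integrableOn_zero (ε' := ℝ)).congr_fun ?_ measurableSet_Ioi
      intro t ht
      exact (h5 t (le_of_lt ht)).symm
    have h7 := h6.lintegral_lt_top
    rw [hi] at h7
    exact lt_irrefl _ h7

lemma averaged_aux (A : H → Set H) (B : H → H) (β : ℝ) (hβ : 0 < β) (hA : MonotoneSV A)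
    (hB : ∀ x y : H, β * ‖B x - B y‖ ^ 2 ≤ ⟪x - y, B x - B y⟫)
    (γ : ℝ) (hγ : γ ∈ Set.Ioo (0:ℝ) (2 * β))
    (J : H → H) (hJ : ∀ w : H, (1 / γ) • (w - J w) ∈ A (J w)) (x y : H) :
    ‖(x + ((4 * β - γ) / (2 * β)) • (J (x - γ • B x) - x)) -
      (y + ((4 * β - γ) / (2 * β)) • (J (y - γ • B y) - y))‖ ≤ ‖x - y‖ := by
  obtain ⟨hγ0, hγ1⟩ := hγ
  set δ := (4 * β - γ) / (2 * β) with hδ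
  have hδ0 : 0 < δ := div_pos (by linarith) (by linarith)
  set a := x - y with ha
  set b := B x - B y with hb
  set d := (J (x - γ • B x) - J (y - γ • B y)) - a with hd
  have h1 := hA _ _ _ _ (hJ (x - γ • B x)) (hJ (y - γ • B y))
  have e1 : (1 / γ) • (x - γ • B x - J (x - γ • B x)) - (1 / γ) • (y - γ • B y - J (y - γ • B y))
      = (1 / γ) • (-(γ • b + d)) := by
    rw [hd, hb, ha]; module
  have e2 : J (x - γ • B x) - J (y - γ • B y) = a + d := by rw [hd]; abel
  rw [e1, e2, inner_smul_left] at h1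
  have h2 : 0 ≤ ⟪-(γ • b + d), a + d⟫ := by
    have : (0:ℝ) < 1 / γ := by positivity
    exact nonneg_of_mul_nonneg_right (by simpa using h1) this
  have h3 := hB x y
  rw [← ha, ← hb] at h3
  have e3 : (x + δ • (J (x - γ • B x) - x)) - (y + δ • (J (y - γ • B y) - y)) = a + δ • d := by
    rw [hd, ha]; module
  rw [e3]
  have h4 : ‖a + δ • d‖ ^ 2 ≤ ‖a‖ ^ 2 := by
    rw [norm_add_sq_real, inner_smul_right, norm_smul, Real.norm_of_nonneg hδ0.le, mul_pow]
    have h5 : 0 ≤ ‖b + (1 / (2 * β)) • d‖ ^ 2 := by positivity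
    rw [norm_add_sq_real, inner_smul_right, norm_smul, Real.norm_of_nonneg (by positivity),
      mul_pow] at h5
    simp only [inner_neg_left, inner_add_left, inner_add_right, inner_smul_left,
      real_inner_self_eq_norm_sq] at h2
    rw [real_inner_comm d a, real_inner_comm b a] at *
    simp only [conj_trivial] at h2
    have e5 : δ = 2 - γ / (2 * β) := by rw [hδ]; field_simp; ring
    have h6 : 2 * ⟪a, d⟫ + δ * ‖d‖ ^ 2 ≤ 0 := by
      have h7 := mul_nonneg (show 0 ≤ 2 * γ * β by positivity) h5
      have e7 : 2 * γ * β * (‖b‖ ^ 2 + 2 * (1 / (2 * β) * ⟪b, d⟫) + (1 / (2 * β)) ^ 2 * ‖d‖ ^ 2)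
        = 2 * γ * (β * ‖b‖ ^ 2) + 2 * γ * ⟪b, d⟫ + γ / (2 * β) * ‖d‖ ^ 2 := by
        field_simp
      rw [e7] at h7
      rw [e5]
      have h8 := mul_le_mul_of_nonneg_left h3 hγ0.le
      simp only [real_inner_comm] at *
      nlinarith
    rw [real_inner_comm] at h6
    nlinarith [mul_nonpos_of_nonneg_of_nonpos hδ0.le h6]
  exact (pow_le_pow_iff_left₀ (norm_nonneg _) (norm_nonneg _) two_ne_zero).1 h4

theorem stmt8 (A : H → Set H) (B : H → H) (β : ℝ) (hβ : 0 < β)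
    (hA : MaximallyMonotone A)
    (hB : ∀ x y : H, β * ‖B x - B y‖ ^ 2 ≤ ⟪x - y, B x - B y⟫)
    (hZer : {z : H | -B z ∈ A z}.Nonempty)
    (γ : ℝ) (hγ : γ ∈ Set.Ioo (0:ℝ) (2 * β))
    (J : H → H) (hJ : ∀ w : H, (1 / γ) • (w - J w) ∈ A (J w))
    (lam eps : ℝ → ℝ) (hlam_meas : Measurable lam) (heps_meas : Measurable eps)
    (heps_range : ∀ t : ℝ, 0 ≤ t → 0 ≤ eps t)
    (hlam_range : ∀ t : ℝ, 0 ≤ t → lam t ∈ Set.Ioc (0:ℝ) ((4 * β - γ) / (2 * β)))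
    (heps_int : ∀ b : ℝ, IntervalIntegrable eps volume 0 b)
    (x₀ : H) (x : ℝ → H)
    (hsol : IsStrongGlobalSolution
      (fun t w => lam t • (J (w - γ • B w) - w) - eps t • w) x₀ x)
    -- (i) ∫₀^∞ ε(t) dt = ∞
    (hi : ∫⁻ t in Set.Ioi (0:ℝ), ENNReal.ofReal (eps t) = ⊤)
    -- (ii) ∫₀^∞ λ(t) dt = ∞
    (hii : ∫⁻ t in Set.Ioi (0:ℝ), ENNReal.ofReal (lam t) = ⊤)
    -- (iii) ε and λ are locally absolutely continuous and ε/λ → 0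
    (hepsAC : ∃ epsd : ℝ → ℝ, (∀ b : ℝ, IntervalIntegrable epsd volume 0 b) ∧
      ∀ t : ℝ, 0 ≤ t → eps t = eps 0 + ∫ s in (0:ℝ)..t, epsd s)
    (hlamAC : ∃ lamd : ℝ → ℝ, (∀ b : ℝ, IntervalIntegrable lamd volume 0 b) ∧
      ∀ t : ℝ, 0 ≤ t → lam t = lam 0 + ∫ s in (0:ℝ)..t, lamd s)
    (hratio : Tendsto (fun t => eps t / lam t) atTop (𝓝 (0:ℝ)))
    -- (iv) ∫₀^∞ |(d/dt)(ε(t)/λ(t))| dt < ∞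
    (hiv : ∃ rd : ℝ → ℝ,
      (∀ t : ℝ, 0 ≤ t → eps t / lam t = eps 0 / lam 0 + ∫ s in (0:ℝ)..t, rd s) ∧
      ∫⁻ t in Set.Ioi (0:ℝ), ENNReal.ofReal |rd t| < ⊤) :
    ∃ p : H, -B p ∈ A p ∧ (∀ q : H, -B q ∈ A q → ‖p‖ ≤ ‖q‖) ∧
      Tendsto x atTop (𝓝 p) := by
  obtain ⟨hxc, hfi, hxe⟩ := hsol
  have hγ' := hγ
  obtain ⟨hγ0, hγ1⟩ := hγ'
  obtain ⟨epsd, hed1, hed2⟩ := hepsAC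
  obtain ⟨lamd, hld1, hld2⟩ := hlamAC
  obtain ⟨rd, hrd1, hrd2⟩ := hiv
  have hec := ac_continuousOn eps epsd hed1 hed2
  have hlc := ac_continuousOn lam lamd hld1 hld2
  have hlpos : ∀ t : ℝ, 0 ≤ t → 0 < lam t := fun t ht => (hlam_range t ht).1
  set δ := (4 * β - γ) / (2 * β) with hδ
  have hδ0 : 0 < δ := div_pos (by linarith) (by linarith)
  set N : H → H := fun w => w + δ • (J (w - γ • B w) - w) with hNdef
  have hN : ∀ y z, ‖N y - N z‖ ≤ ‖y - z‖ := fun y z =>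
    averaged_aux A B β hβ hA.1 hB γ hγ J hJ y z
  have hNc : Continuous N := by
    have : LipschitzWith 1 N := LipschitzWith.of_dist_le_mul (by
      intro y z; simpa [dist_eq_norm] using hN y z)
    exact this.continuous
  have hNT : ∀ w, J (w - γ • B w) - w = (1 / δ) • (N w - w) := by
    intro w
    simp only [hNdef, add_sub_cancel_left, smul_smul]
    rw [one_div, inv_mul_cancel₀ hδ0.ne', one_smul]
  have hfix : ∀ z, N z = z ↔ -B z ∈ A z := by
    intro z
    have h0 : N z = z ↔ J (z - γ • B z) = z := by
      simp only [hNdef, add_eq_left, smul_eq_zero, hδ0.ne', false_or, sub_eq_zero]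
    rw [h0]
    constructor
    · intro h
      have h1 := hJ (z - γ • B z)
      rw [h] at h1
      have : (1 / γ) • (z - γ • B z - z) = -B z := by
        rw [sub_sub_cancel_left, smul_neg, smul_smul, one_div, inv_mul_cancel₀ hγ0.ne', one_smul]
      rwa [this] at h1
    · intro h
      have h1 := hA.1 _ _ _ _ h (hJ (z - γ • B z))
      have e : -B z - (1 / γ) • (z - γ • B z - J (z - γ • B z)) =
          (-(1 / γ)) • (z - J (z - γ • B z)) := by
        have : B z = ((1 / γ) * γ) • B z := by
          rw [one_div, inv_mul_cancel₀ hγ0.ne', one_smul]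
        nth_rewrite 1 [this]
        module
      rw [e, inner_smul_left, real_inner_self_eq_norm_sq] at h1
      simp only [conj_trivial] at h1
      have h2 : 0 < 1 / γ := by positivity
      have h3 : ‖z - J (z - γ • B z)‖ ^ 2 = 0 :=
        le_antisymm (by nlinarith) (by positivity)
      have h4 : z - J (z - γ • B z) = 0 := by simpa using h3
      exact (sub_eq_zero.1 h4).symm
  obtain ⟨z₀, hz₀⟩ := hZer
  obtain ⟨p, hp, hpz⟩ := exists_min_norm N hN ⟨z₀, (hfix z₀).2 hz₀⟩
  refine ⟨p, (hfix p).1 hp, fun q hq => ?_, ?_⟩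
  · have h1 := hpz q ((hfix q).2 hq)
    rw [inner_sub_right, real_inner_self_eq_norm_sq] at h1
    have h2 := real_inner_le_norm p q
    by_contra h3
    push Not at h3
    nlinarith [norm_nonneg q, norm_nonneg p]
  obtain ⟨V, L, hVc, hVlim, hV⟩ := variation_aux eps lam hlpos heps_int hi hratio rd hrd1 hrd2
  set f : ℝ → H := fun s => lam s • (J (x s - γ • B (x s)) - x s) - eps s • x s with hf
  have hfc : ContinuousOn f (Ici 0) := by
    have : f = fun s => lam s • ((1 / δ) • (N (x s) - x s)) - eps s • x s := by
      funext s; simp only [hf, hNT]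
    rw [this]
    exact (hlc.smul (((hNc.comp_continuousOn hxc).sub hxc).const_smul (1 / δ))).sub (hec.smul hxc)
  refine abstract_conv N hN (fun t => lam t / δ) eps (fun t => δ * (eps t / lam t))
    (fun t => δ * V t) (fun t => ∫ s in (0:ℝ)..t, eps s) x (δ * L)
    (fun t ht => div_pos (hlpos t ht) hδ0)
    (fun t ht => mul_nonneg hδ0.le (div_nonneg (heps_range t ht) (hlpos t ht).le))
    (fun t ht => ?_)
    (continuousOn_const.mul (hec.div hlc (fun t ht => (hlpos t ht).ne'))) hxc
    (intervalIntegral.continuous_primitive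
      (fun a b => (heps_int a).symm.trans (heps_int b)) 0).continuousOn
    (continuousOn_const.mul hVc) (fun s hs => ?_)
    (fun s hs => primitive_right_deriv eps hec s hs) (fun s t hs hst => ?_)
    (hVlim.const_mul δ) (primitive_atTop eps heps_range heps_int hi) ?_ p hp hpz
  · have := (hlpos t ht).ne'
    have := hδ0.ne'
    field_simp
  · have h1 := (primitive_right_deriv f hfc s hs).const_add x₀
    have h2 : f s = (lam s / δ) • (N (x s) - x s - (δ * (eps s / lam s)) • x s) := by
      simp only [hf, hNT]
      rw [smul_sub (lam s / δ), smul_smul, smul_smul]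
      have h3 : lam s / δ * (δ * (eps s / lam s)) = eps s := by
        have := (hlpos s hs).ne'
        have := hδ0.ne'
        field_simp
      rw [h3, mul_one_div]
    rw [← h2]
    exact h1.congr (fun t ht => hxe t (hs.trans ht)) (hxe s hs)
  · have h1 := hV s t hs hst
    rw [← mul_sub, ← mul_sub, abs_mul, abs_of_pos hδ0]
    exact mul_le_mul_of_nonneg_left h1 hδ0.le
  · simpa using hratio.const_mul δ
end

section
/- Let H be a real Hilbert space, A : H → Set H monotone, B : H → H β-cocoercive with β > 0, ε ≥ 0 and γ > 0 with γ ≤ 2β/(1 + 2βε), and let J : H → H satisfy (1/γ)(x − J x) ∈ A(J x) for all x ∈ H. Define T : H → H by T x := J( x − γ·(B x + ε·x) ). Then for all x, y ∈ H it holds ‖T x − T y‖ ≤ (1 − γε)·‖x − y‖. -/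
open Filter MeasureTheory Set Topology
open scoped RealInnerProductSpace

variable {H : Type*} [NormedAddCommGroup H] [InnerProductSpace ℝ H] [CompleteSpace H]

theorem stmt10 (A : H → Set H) (B : H → H) (β : ℝ) (hβ : 0 < β)
    (hA : MonotoneSV A)
    (hB : ∀ x y : H, β * ‖B x - B y‖ ^ 2 ≤ ⟪x - y, B x - B y⟫)
    (ε γ : ℝ) (hε : 0 ≤ ε) (hγ : 0 < γ)
    (hγle : γ ≤ 2 * β / (1 + 2 * β * ε))
    (J : H → H) (hJ : ∀ w : H, (1 / γ) • (w - J w) ∈ A (J w)) :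
    ∀ x y : H,
      ‖J (x - γ • (B x + ε • x)) - J (y - γ • (B y + ε • y))‖ ≤
        (1 - γ * ε) * ‖x - y‖ := by
  intro x y
  have hden : 0 < 1 + 2 * β * ε := by positivity
  rw [le_div_iff₀ hden] at hγle
  have hc1 : γ ≤ 2 * β * (1 - γ * ε) := by nlinarith
  have hc : 0 ≤ 1 - γ * ε := by
    by_contra h
    push Not at h
    nlinarith
  have hne : ∀ a b : H, ‖J a - J b‖ ≤ ‖a - b‖ := by
    intro a b
    have h := hA _ _ _ _ (hJ a) (hJ b)
    rw [← smul_sub, real_inner_smul_left] at h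
    have h2 : 0 ≤ ⟪a - J a - (b - J b), J a - J b⟫ := by
      have hg : 0 < 1 / γ := by positivity
      exact nonneg_of_mul_nonneg_right h hg
    have h3 : a - J a - (b - J b) = (a - b) - (J a - J b) := by abel
    rw [h3, inner_sub_left, real_inner_self_eq_norm_sq] at h2
    have h4 := real_inner_le_norm (a - b) (J a - J b)
    by_contra h5
    push Not at h5
    nlinarith [norm_nonneg (a - b), norm_nonneg (J a - J b)]
  refine (hne _ _).trans ?_
  have he : x - γ • (B x + ε • x) - (y - γ • (B y + ε • y))
      = (1 - γ * ε) • (x - y) - γ • (B x - B y) := by module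
  rw [he]
  refine (pow_le_pow_iff_left₀ (norm_nonneg _) (mul_nonneg hc (norm_nonneg _)) two_ne_zero).1 ?_
  rw [norm_sub_sq_real, norm_smul, norm_smul, real_inner_smul_left, real_inner_smul_right,
    Real.norm_of_nonneg hc, Real.norm_of_nonneg hγ.le]
  have h1 := mul_le_mul_of_nonneg_left (hB x y) (mul_nonneg hc hγ.le)
  have h2 := mul_le_mul_of_nonneg_right hc1
    (mul_nonneg hγ.le (sq_nonneg ‖B x - B y‖))
  nlinarith
end

section
/- Let H be a real Hilbert space, A : H → Set H monotone, B : H → H β-cocoercive with β > 0, λ ∈ (0, 1], ε ≥ 0 and γ > 0 with γ ≤ 2β/(1 + 2βε), and let J : H → H satisfy (1/γ)(x − J x) ∈ A(J x) for all x ∈ H. Define T : H → H by T x := J( x − γ·(B x + ε·x) ). Let x̄ ∈ H be a fixed point of T (equivalently, −B x̄ − ε·x̄ ∈ A x̄), let x ∈ H, and set v := λ·(T x − x). Then ⟪v, x − x̄⟫ ≤ (λ/2)·γ·ε·(γ·ε − 2)·‖x − x̄‖². -/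
open Filter MeasureTheory Set Topology
open scoped RealInnerProductSpace

variable {H : Type*} [NormedAddCommGroup H] [InnerProductSpace ℝ H] [CompleteSpace H]

theorem stmt11 (A : H → Set H) (B : H → H) (β : ℝ) (hβ : 0 < β)
    (hA : MonotoneSV A)
    (hB : ∀ x y : H, β * ‖B x - B y‖ ^ 2 ≤ ⟪x - y, B x - B y⟫)
    (lam ε γ : ℝ) (hlam : lam ∈ Set.Ioc (0:ℝ) 1) (hε : 0 ≤ ε) (hγ : 0 < γ)
    (hγle : γ ≤ 2 * β / (1 + 2 * β * ε))
    (J : H → H) (hJ : ∀ w : H, (1 / γ) • (w - J w) ∈ A (J w))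
    (xbar : H) (hxbar : J (xbar - γ • (B xbar + ε • xbar)) = xbar)
    (x : H) :
    ⟪lam • (J (x - γ • (B x + ε • x)) - x), x - xbar⟫ ≤
      (lam / 2) * γ * ε * (γ * ε - 2) * ‖x - xbar‖ ^ 2 := by
  obtain ⟨hl0, _⟩ := hlam
  have hpos : 0 < 1 + 2 * β * ε := by positivity
  rw [le_div_iff₀ hpos] at hγle
  set w := x - γ • (B x + ε • x) with hw
  set wb := xbar - γ • (B xbar + ε • xbar) with hwb
  have hm := hA _ _ _ _ (hJ w) (hJ wb)
  rw [hxbar, ← smul_sub, real_inner_smul_left] at hm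
  have hm2 : 0 ≤ ⟪w - J w - (wb - xbar), J w - xbar⟫ :=
    nonneg_of_mul_nonneg_right hm (by positivity)
  obtain ⟨p, hp⟩ : ∃ p, p = J w - xbar := ⟨_, rfl⟩
  obtain ⟨d, hd⟩ : ∃ d, d = x - xbar := ⟨_, rfl⟩
  obtain ⟨b, hb⟩ : ∃ b, b = B x - B xbar := ⟨_, rfl⟩
  have hc := hB x xbar
  have e1 : w - J w - (wb - xbar) = ((1 - γ * ε) • d - γ • b) - p := by
    rw [hw, hwb, hp, hd, hb]; module
  have e2 : J w - x = p - d := by rw [hp, hd]; abel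
  rw [e1, ← hp] at hm2
  rw [← hd, ← hb] at hc
  rw [e2, ← hd, real_inner_smul_left, inner_sub_left, real_inner_self_eq_norm_sq]
  have h1 := norm_sub_sq_real ((1 - γ * ε) • d - γ • b) p
  have h2 := norm_sub_sq_real ((1 - γ * ε) • d) (γ • b)
  rw [norm_smul, norm_smul, mul_pow, mul_pow, Real.norm_eq_abs, Real.norm_eq_abs, sq_abs, sq_abs,
    real_inner_smul_left, real_inner_smul_right] at h2
  rw [inner_sub_left, real_inner_self_eq_norm_sq] at hm2
  have h3 := norm_sub_sq_real p d
  have h4 := sq_nonneg ‖p - d‖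
  have h5 := sq_nonneg ‖((1 - γ * ε) • d - γ • b) - p‖
  have hge : 0 ≤ 1 - γ * ε := by
    by_contra hcon
    nlinarith
  have h6 : γ * (1 - γ * ε) * (β * ‖b‖ ^ 2) ≤ γ * (1 - γ * ε) * ⟪d, b⟫ :=
    mul_le_mul_of_nonneg_left hc (by positivity)
  have h7 : 0 ≤ (γ * (2 * β - γ * (1 + 2 * β * ε))) * ‖b‖ ^ 2 :=
    mul_nonneg (mul_nonneg hγ.le (by linarith)) (by positivity)
  have h8 : ⟪p, d⟫ - ‖d‖ ^ 2 ≤ (1 / 2) * γ * ε * (γ * ε - 2) * ‖d‖ ^ 2 := by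
    linarith
  have h9 := mul_le_mul_of_nonneg_left h8 hl0.le
  linarith
end

section
/- Let H be a real Hilbert space, A : H → Set H maximally monotone, B : H → H β-cocoercive with β > 0 and Zer(A + B) nonempty. Let λ : [0, ∞) → (0, 1], ε : [0, ∞) → (0, ∞) and γ : [0, ∞) → (0, 2β) be Lebesgue measurable with γ(t) ≤ 2β/(1 + 2βε(t)) for all t ≥ 0, for each t ≥ 0 let J_t : H → H be a resolvent of γ(t)·A, and let x be the strong global solution of ẋ(t) = λ(t)·( J_t( x(t) − γ(t)·(B(x(t)) + ε(t)·x(t)) ) − x(t) ), x(0) = x₀ ∈ H. Assume: (i) ε is locally absolutely continuous, nonincreasing, and ε(t) → 0 as t → ∞; (ii) ε̇(t) / (ε(t)²·λ(t)·γ(t)) → 0 as t → ∞; (iii) ∫₀^∞ λ(t)·γ(t)·ε(t)·(2 − γ(t)·ε(t)) dt = ∞. Then x(t) converges strongly, as t → ∞, to P_{Zer(A+B)} 0, the minimum-norm zero of A + B. -/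
open Filter MeasureTheory Set Topology
open scoped RealInnerProductSpace

variable {H : Type*} [NormedAddCommGroup H] [InnerProductSpace ℝ H] [CompleteSpace H]

lemma aux_ac_of_dist_le {u G : ℝ → ℝ} {a b : ℝ} (hG : AbsolutelyContinuousOnInterval G a b)
    (h : ∀ s ∈ uIcc a b, ∀ t ∈ uIcc a b, dist (u s) (u t) ≤ dist (G s) (G t)) :
    AbsolutelyContinuousOnInterval u a b := by
  rw [absolutelyContinuousOnInterval_iff] at hG ⊢
  intro ε hε
  obtain ⟨δ, hδ, H⟩ := hG ε hε
  refine ⟨δ, hδ, fun E hE hl => lt_of_le_of_lt ?_ (H E hE hl)⟩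
  exact Finset.sum_le_sum fun i hi => h _ (hE.1 i hi).1 _ (hE.1 i hi).2

lemma aux_exp_dist {a b C : ℝ} (ha : a ≤ C) (hb : b ≤ C) :
    dist (Real.exp a) (Real.exp b) ≤ dist (Real.exp C * a) (Real.exp C * b) := by
  have key : ‖Real.exp b - Real.exp a‖ ≤ Real.exp C * ‖b - a‖ := by
    refine Convex.norm_image_sub_le_of_norm_hasDerivWithin_le (s := Iic C) (f := Real.exp)
      (f' := Real.exp) (fun x _ => (Real.hasDerivAt_exp x).hasDerivWithinAt) ?_ (convex_Iic C) ha hb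
    intro x hx
    rw [Real.norm_of_nonneg (Real.exp_pos x).le]
    exact Real.exp_le_exp.2 hx
  rw [dist_comm, dist_comm (Real.exp C * a), Real.dist_eq, Real.dist_eq, ← mul_sub, abs_mul,
    abs_of_pos (Real.exp_pos C)]
  exact key

lemma aux_antitone {w : ℝ → ℝ} {a b : ℝ} (hab : a ≤ b) (hw : AbsolutelyContinuousOnInterval w a b)
    (h : ∀ᵐ t, t ∈ Ioc a b → deriv w t ≤ 0) : w b ≤ w a := by
  have h1 := hw.integral_deriv_eq_sub
  have h2 : ∫ t in a..b, deriv w t ≤ 0 := by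
    rw [intervalIntegral.integral_of_le hab]
    apply integral_nonpos_of_ae
    exact (ae_restrict_iff' measurableSet_Ioc).2 h
  linarith

lemma aux_gronwall {u g : ℝ → ℝ} (hu0 : ∀ t, 0 ≤ t → 0 ≤ u t)
    (hg0 : ∀ t, 0 ≤ t → 0 ≤ g t) (hgi : ∀ b, 0 ≤ b → IntervalIntegrable g volume 0 b)
    (hgt : Tendsto (fun b => ∫ t in (0:ℝ)..b, g t) atTop atTop)
    (huac : ∀ b, 0 ≤ b → AbsolutelyContinuousOnInterval u 0 b)
    (hd : ∀ δ > 0, ∃ T, 0 ≤ T ∧ ∀ b, ∀ᵐ t, t ∈ Ioc T b → DifferentiableAt ℝ u t →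
      deriv u t ≤ - g t * (u t - δ)) :
    Tendsto u atTop (𝓝 0) := by
  have key : ∀ δ > 0, ∀ᶠ t in atTop, u t < 2 * δ := by
    intro δ hδ
    obtain ⟨T, hT, hTd⟩ := hd δ hδ
    set Λ : ℝ → ℝ := fun b => ∫ t in (0:ℝ)..b, g t with hΛ
    have hbd : ∀ b, T ≤ b → (u b - δ) * Real.exp (Λ b) ≤ (u T - δ) * Real.exp (Λ T) := by
      intro b hb
      have hb0 : 0 ≤ b := hT.trans hb
      have hsub : uIcc T b ⊆ uIcc 0 b := by
        rw [uIcc_of_le hb, uIcc_of_le hb0]; exact Icc_subset_Icc_left hT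
      have hΛac : AbsolutelyContinuousOnInterval Λ 0 b :=
        (hgi b hb0).absolutelyContinuousOnInterval_intervalIntegral (by simp)
      have hΛm : ∀ s ∈ uIcc 0 b, Λ s ≤ Λ b := by
        intro s hs
        rw [uIcc_of_le hb0] at hs
        have h1 : IntervalIntegrable g volume 0 s := hgi s hs.1
        have h2 : IntervalIntegrable g volume s b := h1.symm.trans (hgi b hb0)
        have h3 := intervalIntegral.integral_add_adjacent_intervals h1 h2
        have h4 : 0 ≤ ∫ t in s..b, g t :=
          intervalIntegral.integral_nonneg hs.2 fun t ht => hg0 t (hs.1.trans ht.1)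
        simp only [hΛ]; linarith
      have hexp : AbsolutelyContinuousOnInterval (fun t => Real.exp (Λ t)) 0 b :=
        aux_ac_of_dist_le (hΛac.const_mul (Real.exp (Λ b))) fun s hs t ht =>
          aux_exp_dist (hΛm s hs) (hΛm t ht)
      have hconst : AbsolutelyContinuousOnInterval (fun _ : ℝ => δ) 0 b :=
        aux_ac_of_dist_le hΛac fun s hs t ht => by simp
      have hw : AbsolutelyContinuousOnInterval (fun t => (u t - δ) * Real.exp (Λ t)) T b :=
        (((huac b hb0).sub hconst).mul hexp).mono hsub
      refine aux_antitone hb hw ?_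
      filter_upwards [hTd b, (huac b hb0).ae_differentiableAt,
        (hgi b hb0).ae_hasDerivAt_integral] with t h1 h2 h3 ht
      have ht' : t ∈ uIcc 0 b := by
        rw [uIcc_of_le hb0]; exact ⟨hT.trans ht.1.le, ht.2⟩
      have hu := h2 ht'
      have h4 := h1 ht hu
      have h5 : HasDerivAt Λ (g t) t := h3 ht' 0 (by simp)
      have h6 := ((hu.hasDerivAt.sub_const δ).mul h5.exp).deriv
      have h6' : deriv (fun t => (u t - δ) * Real.exp (Λ t)) t =
        deriv u t * Real.exp (Λ t) + (u t - δ) * (Real.exp (Λ t) * g t) := h6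
      rw [h6']
      have := mul_le_mul_of_nonneg_right h4 (Real.exp_pos (Λ t)).le
      nlinarith
    have hlim : Tendsto (fun b => (u T - δ) * Real.exp (Λ T) * Real.exp (-Λ b)) atTop (𝓝 0) := by
      have := (Real.tendsto_exp_neg_atTop_nhds_zero.comp hgt).const_mul
        ((u T - δ) * Real.exp (Λ T))
      simpa using this
    filter_upwards [hlim.eventually (gt_mem_nhds hδ), eventually_ge_atTop T] with b h1 h2
    have h3 := mul_le_mul_of_nonneg_right (hbd b h2) (Real.exp_pos (-Λ b)).le
    rw [mul_assoc, ← Real.exp_add] at h3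
    simp at h3
    linarith
  rw [Metric.tendsto_atTop']
  intro ε hε
  obtain ⟨N, hN⟩ := eventually_atTop.1 (key (ε / 2) (by positivity))
  refine ⟨max N 0, fun n hn => ?_⟩
  have h1 := hN n ((le_max_left _ _).trans hn.le)
  have h2 := hu0 n ((le_max_right _ _).trans hn.le)
  rw [Real.dist_eq, sub_zero, abs_of_nonneg h2]; linarith

lemma aux_tik_mono {A : H → Set H} {B : H → H} {β : ℝ} (hβ : 0 < β)
    (hA : MonotoneSV A)
    (hB : ∀ x y : H, β * ‖B x - B y‖ ^ 2 ≤ ⟪x - y, B x - B y⟫) {e1 e2 : ℝ} {y1 y2 : H}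
    (h1 : -(B y1 + e1 • y1) ∈ A y1) (h2 : -(B y2 + e2 • y2) ∈ A y2) :
    e2 * ⟪y2, y2 - y1⟫ ≤ e1 * ⟪y1, y2 - y1⟫ := by
  have h := hA _ _ _ _ h2 h1
  have hb : 0 ≤ ⟪y2 - y1, B y2 - B y1⟫ := le_trans (by positivity) (hB y2 y1)
  have e : -(B y2 + e2 • y2) - -(B y1 + e1 • y1) = -(B y2 - B y1) - e2 • y2 + e1 • y1 := by abel
  rw [e, inner_add_left, inner_sub_left, inner_neg_left, real_inner_smul_left,
    real_inner_smul_left, real_inner_comm] at h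
  linarith

lemma aux_tik_norm {A : H → Set H} {B : H → H} {β : ℝ} (hβ : 0 < β)
    (hA : MonotoneSV A)
    (hB : ∀ x y : H, β * ‖B x - B y‖ ^ 2 ≤ ⟪x - y, B x - B y⟫) {e : ℝ} (he : 0 < e) {y q : H}
    (h1 : -(B y + e • y) ∈ A y) (hq : -B q ∈ A q) : ‖y‖ ≤ ‖q‖ := by
  have h := aux_tik_mono hβ hA hB (e1 := 0) (y1 := q) (by simpa using hq) h1
  rw [zero_mul, inner_sub_right, real_inner_self_eq_norm_sq] at h
  have h2 := real_inner_le_norm y q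
  have h3 : ‖y‖ ^ 2 ≤ ‖y‖ * ‖q‖ := by
    have := nonpos_of_mul_nonpos_right h he
    linarith
  rcases (norm_nonneg y).eq_or_lt with h0 | h0
  · rw [← h0]; exact norm_nonneg q
  · rw [sq] at h3; exact le_of_mul_le_mul_left h3 h0

/-- Lipschitz and Pythagoras-type estimates along the Tikhonov curve. -/
lemma aux_tik_two {A : H → Set H} {B : H → H} {β : ℝ} (hβ : 0 < β)
    (hA : MonotoneSV A)
    (hB : ∀ x y : H, β * ‖B x - B y‖ ^ 2 ≤ ⟪x - y, B x - B y⟫) {e1 e2 : ℝ} (he : 0 < e2)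
    (hle : e2 ≤ e1) {y1 y2 : H}
    (h1 : -(B y1 + e1 • y1) ∈ A y1) (h2 : -(B y2 + e2 • y2) ∈ A y2) :
    ‖y2 - y1‖ ≤ (e1 - e2) / e2 * ‖y1‖ ∧ ‖y2 - y1‖ ^ 2 ≤ ‖y2‖ ^ 2 - ‖y1‖ ^ 2 := by
  have h := aux_tik_mono hβ hA hB h1 h2
  set d := y2 - y1 with hd
  have hy : y2 = y1 + d := by rw [hd]; abel
  rw [hy, inner_add_left, real_inner_self_eq_norm_sq] at h
  have h3 : e2 * ‖d‖ ^ 2 ≤ (e1 - e2) * ⟪y1, d⟫ := by linarith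
  have hcs := real_inner_le_norm y1 d
  constructor
  · rcases (norm_nonneg d).eq_or_lt with h0 | h0
    · rw [← h0]; have : 0 ≤ e1 - e2 := by linarith
      positivity
    · have h4 : e2 * ‖d‖ ^ 2 ≤ (e1 - e2) * (‖y1‖ * ‖d‖) :=
        h3.trans (mul_le_mul_of_nonneg_left hcs (by linarith))
      have h5 : e2 * ‖d‖ ≤ (e1 - e2) * ‖y1‖ := by
        apply le_of_mul_le_mul_right _ h0; linarith
      rw [div_mul_eq_mul_div, le_div_iff₀ he]; linarith
  · have h4 : 0 ≤ ⟪y1, d⟫ := by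
      rcases hle.eq_or_lt with h0 | h0
      · rw [← h0, sub_self, zero_mul] at h3
        have : ‖d‖ ^ 2 ≤ 0 := nonpos_of_mul_nonpos_right h3 he
        have : d = 0 := by
          have := pow_eq_zero_iff (two_ne_zero) |>.1 (le_antisymm this (by positivity))
          simpa using this
        simp [this]
      · have : 0 ≤ (e1 - e2) * ⟪y1, d⟫ := le_trans (by positivity) h3
        exact nonneg_of_mul_nonneg_right this (by linarith)
    rw [hy, norm_add_sq_real]; linarith

lemma aux_res_nonexp {A : H → Set H} (hA : MonotoneSV A) {g : ℝ} (hg : 0 < g) {J : H → H}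
    (hJ : ∀ w : H, (1 / g) • (w - J w) ∈ A (J w)) (v w : H) : ‖J v - J w‖ ≤ ‖v - w‖ := by
  have h := hA _ _ _ _ (hJ v) (hJ w)
  rw [← smul_sub, real_inner_smul_left] at h
  have h1 := nonneg_of_mul_nonneg_right h (by positivity)
  have e : v - J v - (w - J w) = (v - w) - (J v - J w) := by abel
  rw [e, inner_sub_left, real_inner_self_eq_norm_sq] at h1
  have h2 := real_inner_le_norm (v - w) (J v - J w)
  rcases (norm_nonneg (J v - J w)).eq_or_lt with h0 | h0
  · rw [← h0]; exact norm_nonneg _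
  · apply le_of_mul_le_mul_right _ h0; nlinarith

lemma aux_contr {A : H → Set H} {B : H → H} {β : ℝ} (hβ : 0 < β)
    (hA : MonotoneSV A)
    (hB : ∀ x y : H, β * ‖B x - B y‖ ^ 2 ≤ ⟪x - y, B x - B y⟫) {e g : ℝ} (he : 0 < e)
    (hg : 0 < g) (hge : g ≤ 2 * β / (1 + 2 * β * e)) {J : H → H}
    (hJ : ∀ w : H, (1 / g) • (w - J w) ∈ A (J w)) :
    0 < 1 - g * e ∧ ∀ v w : H,
    ‖J (v - g • (B v + e • v)) - J (w - g • (B w + e • w))‖ ≤ (1 - g * e) * ‖v - w‖ := by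
  have hpos : 0 < 1 + 2 * β * e := by positivity
  have h1 : g * (1 + 2 * β * e) ≤ 2 * β := (le_div_iff₀ hpos).1 hge
  have h2 : g ≤ 2 * β * (1 - g * e) := by linarith
  have h3 : 0 < 1 - g * e := by
    by_contra hc
    have : 2 * β * (1 - g * e) ≤ 0 := mul_nonpos_of_nonneg_of_nonpos (by positivity) (not_lt.1 hc)
    linarith
  refine ⟨h3, fun v w => (aux_res_nonexp hA hg hJ _ _).trans ?_⟩
  have e1 : v - g • (B v + e • v) - (w - g • (B w + e • w)) =
      (1 - g * e) • (v - w) - g • (B v - B w) := by module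
  rw [e1]
  refine abs_le_of_sq_le_sq' ?_ (by positivity) |>.2
  rw [norm_sub_sq_real, real_inner_smul_left, real_inner_smul_right, norm_smul, norm_smul,
    Real.norm_of_nonneg h3.le, Real.norm_of_nonneg hg.le]
  have hb := hB v w
  have h4 := mul_le_mul_of_nonneg_left hb (by positivity : 0 ≤ 2 * g * (1 - g * e))
  have h5 : g * ‖B v - B w‖ ^ 2 * g ≤ g * ‖B v - B w‖ ^ 2 * (2 * β * (1 - g * e)) :=
    mul_le_mul_of_nonneg_left h2 (by positivity)
  nlinarith

lemma aux_tik_exists {A : H → Set H} {B : H → H} {β : ℝ} (hβ : 0 < β)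
    (hA : MonotoneSV A)
    (hB : ∀ x y : H, β * ‖B x - B y‖ ^ 2 ≤ ⟪x - y, B x - B y⟫) {e g : ℝ} (he : 0 < e)
    (hg : 0 < g) (hge : g ≤ 2 * β / (1 + 2 * β * e)) {J : H → H}
    (hJ : ∀ w : H, (1 / g) • (w - J w) ∈ A (J w)) :
    ∃ y : H, J (y - g • (B y + e • y)) = y ∧ -(B y + e • y) ∈ A y := by
  obtain ⟨h0, hc⟩ := aux_contr hβ hA hB he hg hge hJ
  have hct : ContractingWith (1 - g * e).toNNReal
      (fun y => J (y - g • (B y + e • y))) := by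
    refine ⟨?_, LipschitzWith.of_dist_le_mul fun v w => ?_⟩
    · rw [Real.toNNReal_lt_one]; nlinarith
    · rw [dist_eq_norm, dist_eq_norm, Real.coe_toNNReal _ h0.le]; exact hc v w
  refine ⟨hct.fixedPoint, hct.fixedPoint_isFixedPt, ?_⟩
  set y := hct.fixedPoint
  have hy : J (y - g • (B y + e • y)) = y := hct.fixedPoint_isFixedPt
  have h := hJ (y - g • (B y + e • y))
  rw [hy] at h
  have e1 : (1 / g) • (y - g • (B y + e • y) - y) = -(B y + e • y) := by
    rw [sub_sub_cancel_left, smul_neg, smul_smul, one_div_mul_cancel hg.ne', one_smul]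
  rwa [e1] at h

lemma aux_tik_lim {A : H → Set H} {B : H → H} {β : ℝ} (hβ : 0 < β)
    (hA : MaximallyMonotone A)
    (hB : ∀ x y : H, β * ‖B x - B y‖ ^ 2 ≤ ⟪x - y, B x - B y⟫)
    (hZer : {z : H | -B z ∈ A z}.Nonempty) {eps : ℝ → ℝ} {y : ℝ → H}
    (heps_pos : ∀ t : ℝ, 0 ≤ t → 0 < eps t)
    (heps_mono : ∀ s t : ℝ, 0 ≤ s → s ≤ t → eps t ≤ eps s)
    (heps_lim : Tendsto eps atTop (𝓝 (0:ℝ)))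
    (hy : ∀ t, 0 ≤ t → -(B (y t) + eps t • y t) ∈ A (y t)) :
    ∃ p : H, -B p ∈ A p ∧ (∀ q : H, -B q ∈ A q → ‖p‖ ≤ ‖q‖) ∧ Tendsto y atTop (𝓝 p) := by
  obtain ⟨q, hq⟩ := hZer
  have hmn : ∀ s t, 0 ≤ s → s ≤ t → ‖y t - y s‖ ^ 2 ≤ ‖y t‖ ^ 2 - ‖y s‖ ^ 2 := fun s t hs hst =>
    (aux_tik_two hβ hA.1 hB (heps_pos t (hs.trans hst)) (heps_mono s t hs hst) (hy s hs)
      (hy t (hs.trans hst))).2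
  have hcau : CauchySeq y := by
    set S := (fun t => ‖y t‖ ^ 2) '' Ici 0 with hS
    have hbdd : BddAbove S := by
      refine ⟨‖q‖ ^ 2, ?_⟩
      rintro _ ⟨t, ht, rfl⟩
      have := aux_tik_norm hβ hA.1 hB (heps_pos t ht) (hy t ht) hq
      exact pow_le_pow_left₀ (norm_nonneg _) this 2
    have hne : S.Nonempty := ⟨_, 0, by simp, rfl⟩
    rw [Metric.cauchySeq_iff']
    intro ε hε
    obtain ⟨_, ⟨N, hN, rfl⟩, hlt⟩ := exists_lt_of_lt_csSup hne
      (show sSup S - ε ^ 2 < sSup S by nlinarith)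
    refine ⟨N, fun n hn => ?_⟩
    have h1 := hmn N n hN hn
    have h2 : ‖y n‖ ^ 2 ≤ sSup S := le_csSup hbdd ⟨n, le_trans hN hn, rfl⟩
    rw [dist_eq_norm]
    refine lt_of_pow_lt_pow_left₀ 2 hε.le ?_
    simp only at hlt
    linarith
  obtain ⟨p, hp⟩ := cauchySeq_tendsto_of_complete hcau
  have hBc : Continuous B := by
    have : LipschitzWith (1 / β).toNNReal B := by
      refine LipschitzWith.of_dist_le_mul fun v w => ?_
      rw [dist_eq_norm, dist_eq_norm, Real.coe_toNNReal _ (by positivity)]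
      have h1 := hB v w
      have h2 := real_inner_le_norm (v - w) (B v - B w)
      rw [div_mul_eq_mul_div, le_div_iff₀ hβ]
      rcases (norm_nonneg (B v - B w)).eq_or_lt with h0 | h0
      · rw [← h0]; simp
      · apply le_of_mul_le_mul_right _ h0; nlinarith
    exact this.continuous
  refine ⟨p, ?_, ?_, hp⟩
  · apply hA.2
    intro z v hv
    have hl : Tendsto (fun t => ⟪-(B (y t) + eps t • y t) - v, y t - z⟫) atTop
        (𝓝 ⟪-(B p + (0:ℝ) • p) - v, p - z⟫) :=
      Tendsto.inner (((((hBc.tendsto p).comp hp).add (heps_lim.smul hp)).neg).sub_const v)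
        (hp.sub_const z)
    rw [zero_smul, add_zero] at hl
    refine ge_of_tendsto hl ?_
    filter_upwards [eventually_ge_atTop 0] with t ht
    exact hA.1 _ _ _ _ (hy t ht) hv
  · intro q hq
    refine le_of_tendsto hp.norm ?_
    filter_upwards [eventually_ge_atTop 0] with t ht
    exact aux_tik_norm hβ hA.1 hB (heps_pos t ht) (hy t ht) hq

/-- Pointwise estimate of the derivative of the distance to the Tikhonov curve. -/
lemma aux_deriv_le {x y : ℝ → H} {eps : ℝ → ℝ} {t l c ed M : ℝ} {T : H}
    (hl0 : 0 < l) (hM : 0 ≤ M)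
    (het : 0 < eps t)
    (hxd : HasDerivAt x (l • (T - x t)) t) (hed : HasDerivAt eps ed t)
    (hT : ‖T - y t‖ ≤ (1 - c) * ‖x t - y t‖)
    (hyL : ∀ s, t < s → ‖y s - y t‖ ≤ (eps t - eps s) / eps s * M)
    (hu : DifferentiableAt ℝ (fun s => ‖x s - y s‖) t) :
    deriv (fun s => ‖x s - y s‖) t ≤ -(l * c) * ‖x t - y t‖ + |ed| / eps t * M := by
  set u := fun s => ‖x s - y s‖ with hudef
  have hmono : 𝓝[>] t ≤ 𝓝[≠] t := nhdsWithin_mono _ fun s hs => ne_of_gt hs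
  have h1 := (hasDerivAt_iff_tendsto_slope.1 hu.hasDerivAt).mono_left hmono
  have h2 := (hasDerivAt_iff_tendsto_slope.1 hxd).mono_left hmono
  have h3 := (hasDerivAt_iff_tendsto_slope.1 hed).mono_left hmono
  have h4 : Tendsto eps (𝓝[>] t) (𝓝 (eps t)) :=
    (hed.continuousAt.tendsto).mono_left nhdsWithin_le_nhds
  have h5 : Tendsto (fun s => ‖slope x t s - l • (T - x t)‖ + (-(l * c) * ‖x t - y t‖) +
      (-slope eps t s) / eps s * M) (𝓝[>] t)
      (𝓝 (0 + (-(l * c) * ‖x t - y t‖) + (-ed) / eps t * M)) := by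
    refine Tendsto.add (Tendsto.add ?_ tendsto_const_nhds) ((h3.neg.div h4 het.ne').mul_const M)
    have := (h2.sub_const (l • (T - x t))).norm
    simpa using this
  have h6 : deriv u t ≤ 0 + (-(l * c) * ‖x t - y t‖) + (-ed) / eps t * M := by
    refine le_of_tendsto_of_tendsto h1 h5 ?_
    have hsm : ∀ᶠ s in 𝓝[>] t, s < t + 1 / l :=
      mem_nhdsWithin_of_mem_nhds (Iio_mem_nhds (by have : 0 < 1 / l := by positivity
                                                   linarith))
    filter_upwards [self_mem_nhdsWithin, hsm] with s hs hs2
    have hs' : 0 < s - t := sub_pos.2 hs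
    have hsl : (s - t) * l < 1 := by
      rw [← lt_div_iff₀ hl0]; linarith
    rw [slope_def_field, div_le_iff₀ hs']
    have e1 : slope x t s - l • (T - x t) = (s - t)⁻¹ • (x s - x t - (s - t) • l • (T - x t)) := by
      rw [slope_def_module, smul_sub ((s - t)⁻¹) (x s - x t), inv_smul_smul₀ hs'.ne']
    have e2 : ‖x s - x t - (s - t) • l • (T - x t)‖ =
        ‖slope x t s - l • (T - x t)‖ * (s - t) := by
      rw [e1, norm_smul, norm_inv, Real.norm_of_nonneg hs'.le]; field_simp
    have e3 : (-slope eps t s) / eps s * M * (s - t) = (eps t - eps s) / eps s * M := by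
      rw [slope_def_field]; field_simp; ring
    have e4 : x s - y s = (x s - x t - (s - t) • l • (T - x t)) +
        ((1 - (s - t) * l) • (x t - y t) + ((s - t) * l) • (T - y t)) - (y s - y t) := by module
    have e5 : ‖(1 - (s - t) * l) • (x t - y t) + ((s - t) * l) • (T - y t)‖ ≤
        (1 - (s - t) * l) * ‖x t - y t‖ + ((s - t) * l) * ((1 - c) * ‖x t - y t‖) := by
      refine (norm_add_le _ _).trans ?_
      rw [norm_smul, norm_smul, Real.norm_of_nonneg (by linarith),
        Real.norm_of_nonneg (by positivity)]
      gcongr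
    have e6 : u s ≤ ‖x s - x t - (s - t) • l • (T - x t)‖ +
        ‖(1 - (s - t) * l) • (x t - y t) + ((s - t) * l) • (T - y t)‖ + ‖y s - y t‖ := by
      simp only [hudef]
      conv_lhs => rw [e4]
      exact (norm_sub_le _ _).trans (by gcongr; exact norm_add_le _ _)
    have e7 := hyL s hs
    rw [add_mul, add_mul, e3, ← e2]
    have e8 : u t = ‖x t - y t‖ := rfl
    rw [e8]
    linarith
  have h7 : (-ed) / eps t * M ≤ |ed| / eps t * M := by
    gcongr; exact neg_le_abs ed
  linarith

lemma aux_int_top {g k : ℝ → ℝ} (hg0 : ∀ t, 0 ≤ t → 0 ≤ g t) 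
    (hgi : ∀ b, 0 ≤ b → IntervalIntegrable g volume 0 b)
    (hk : ∀ t, 0 ≤ t → k t ≤ 2 * g t)
    (hiii : ∫⁻ t in Set.Ioi (0:ℝ), ENNReal.ofReal (k t) = ⊤) :
    Tendsto (fun b => ∫ t in (0:ℝ)..b, g t) atTop atTop := by
  rw [tendsto_atTop]
  intro C
  have hex : ∃ b, 0 ≤ b ∧ C ≤ ∫ t in (0:ℝ)..b, g t := by
    by_contra! hc
    have hint : IntegrableOn g (Ioi 0) := by
      refine integrableOn_Ioi_of_intervalIntegral_norm_bounded (l := atTop) (b := id) C 0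
        (fun b => ?_) tendsto_id ?_
      · rcases le_total 0 b with hb | hb
        · exact (intervalIntegrable_iff_integrableOn_Ioc_of_le hb).1 (hgi b hb)
        · simp [Ioc_eq_empty_of_le hb]
      · filter_upwards [eventually_ge_atTop 0] with b hb
        have : ∫ t in (0:ℝ)..id b, ‖g t‖ = ∫ t in (0:ℝ)..b, g t := by
          apply intervalIntegral.integral_congr
          intro t ht
          simp only [id] at ht
          rw [uIcc_of_le hb] at ht
          exact Real.norm_of_nonneg (hg0 t ht.1)
        rw [this]; exact (hc b hb).le
    have h2 : IntegrableOn (fun t => 2 * g t) (Ioi 0) := hint.const_mul 2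
    have h3 : ∫⁻ t in Set.Ioi (0:ℝ), ENNReal.ofReal (k t) < ⊤ := by
      refine lt_of_le_of_lt (setLIntegral_mono' measurableSet_Ioi fun t ht =>
        ENNReal.ofReal_le_ofReal (hk t (le_of_lt ht))) ?_
      exact (lintegral_ofReal_le_lintegral_enorm _).trans_lt h2.2
    exact h3.ne hiii
  obtain ⟨b, hb0, hb⟩ := hex
  filter_upwards [eventually_ge_atTop b] with s hs
  have h1 := hgi b hb0
  have h2 : IntervalIntegrable g volume b s := h1.symm.trans (hgi s (hb0.trans hs))
  have h3 := intervalIntegral.integral_add_adjacent_intervals h1 h2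
  have h4 : 0 ≤ ∫ t in b..s, g t :=
    intervalIntegral.integral_nonneg hs fun t ht => hg0 t (hb0.trans ht.1)
  linarith

theorem stmt12 (A : H → Set H) (B : H → H) (β : ℝ) (hβ : 0 < β)
    (hA : MaximallyMonotone A)
    (hB : ∀ x y : H, β * ‖B x - B y‖ ^ 2 ≤ ⟪x - y, B x - B y⟫)
    (hZer : {z : H | -B z ∈ A z}.Nonempty)
    (lam eps γ : ℝ → ℝ)
    (hlam_meas : Measurable lam) (heps_meas : Measurable eps) (hγ_meas : Measurable γ)
    (hlam_range : ∀ t : ℝ, 0 ≤ t → lam t ∈ Set.Ioc (0:ℝ) 1)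
    (heps_pos : ∀ t : ℝ, 0 ≤ t → 0 < eps t)
    (hγ_range : ∀ t : ℝ, 0 ≤ t → γ t ∈ Set.Ioo (0:ℝ) (2 * β))
    (hγle : ∀ t : ℝ, 0 ≤ t → γ t ≤ 2 * β / (1 + 2 * β * eps t))
    (J : ℝ → H → H)
    (hJ : ∀ t : ℝ, 0 ≤ t → ∀ w : H, (1 / γ t) • (w - J t w) ∈ A (J t w))
    (x₀ : H) (x : ℝ → H)
    (hsol : IsStrongGlobalSolution
      (fun t w => lam t • (J t (w - γ t • (B w + eps t • w)) - w)) x₀ x)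
    -- (i) ε is locally absolutely continuous (with derivative epsd),
    -- nonincreasing, and ε(t) → 0 as t → ∞
    (epsd : ℝ → ℝ)
    (hepsd_int : ∀ b : ℝ, IntervalIntegrable epsd volume 0 b)
    (hepsAC : ∀ t : ℝ, 0 ≤ t → eps t = eps 0 + ∫ s in (0:ℝ)..t, epsd s)
    (heps_mono : ∀ s t : ℝ, 0 ≤ s → s ≤ t → eps t ≤ eps s)
    (heps_lim : Tendsto eps atTop (𝓝 (0:ℝ)))
    -- (ii) ε̇(t) / (ε(t)²·λ(t)·γ(t)) → 0 as t → ∞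
    (hii : Tendsto (fun t => epsd t / (eps t ^ 2 * lam t * γ t)) atTop (𝓝 (0:ℝ)))
    -- (iii) ∫₀^∞ λ(t)·γ(t)·ε(t)·(2 − γ(t)·ε(t)) dt = ∞
    (hiii : ∫⁻ t in Set.Ioi (0:ℝ),
      ENNReal.ofReal (lam t * γ t * eps t * (2 - γ t * eps t)) = ⊤) :
    ∃ p : H, -B p ∈ A p ∧ (∀ q : H, -B q ∈ A q → ‖p‖ ≤ ‖q‖) ∧
      Tendsto x atTop (𝓝 p) := by
  obtain ⟨hxc, hfi, hxe⟩ := hsol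
  have hex : ∀ t : ℝ, ∃ y : H, 0 ≤ t →
      (J t (y - γ t • (B y + eps t • y)) = y ∧ -(B y + eps t • y) ∈ A y) := by
    intro t
    by_cases ht : 0 ≤ t
    · obtain ⟨y, hy⟩ := aux_tik_exists hβ hA.1 hB (heps_pos t ht) (hγ_range t ht).1 (hγle t ht)
        (hJ t ht)
      exact ⟨y, fun _ => hy⟩
    · exact ⟨0, fun h => absurd h ht⟩
  choose y hy using hex
  obtain ⟨p, hpz, hpm, hpl⟩ := aux_tik_lim hβ hA hB hZer heps_pos heps_mono heps_lim
    fun t ht => (hy t ht).2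
  refine ⟨p, hpz, hpm, ?_⟩
  set M := ‖p‖ with hM
  have hyM : ∀ t, 0 ≤ t → ‖y t‖ ≤ M := fun t ht =>
    aux_tik_norm hβ hA.1 hB (heps_pos t ht) (hy t ht).2 hpz
  have hyL : ∀ s t, 0 ≤ s → s ≤ t → ‖y t - y s‖ ≤ (eps s - eps t) / eps t * M := by
    intro s t hs hst
    have ht := hs.trans hst
    have hm := heps_mono s t hs hst
    refine (aux_tik_two hβ hA.1 hB (heps_pos t ht) hm (hy s hs).2 (hy t ht).2).1.trans ?_
    exact mul_le_mul_of_nonneg_left (hyM s hs)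
      (div_nonneg (by linarith) (heps_pos t ht).le)
  set f : ℝ → H := fun t => lam t • (J t (x t - γ t • (B (x t) + eps t • x t)) - x t) with hf
  have hfi' : ∀ b, IntervalIntegrable f volume 0 b := hfi
  have hxe' : ∀ t, 0 ≤ t → x t = x₀ + ∫ s in (0:ℝ)..t, f s := hxe
  set u : ℝ → ℝ := fun t => ‖x t - y t‖ with hu
  set g : ℝ → ℝ := fun t => lam t * (γ t * eps t) with hg
  have hgpos : ∀ t, 0 ≤ t → 0 < g t := fun t ht =>
    mul_pos (hlam_range t ht).1 (mul_pos (hγ_range t ht).1 (heps_pos t ht))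
  have hgi : ∀ b, 0 ≤ b → IntervalIntegrable g volume 0 b := by
    intro b hb
    have hgm : Measurable g := hlam_meas.mul (hγ_meas.mul heps_meas)
    rw [intervalIntegrable_iff_integrableOn_Ioc_of_le hb]
    refine Measure.integrableOn_of_bounded (M := 1 * (2 * β * eps 0)) (by simp)
      hgm.aestronglyMeasurable ?_
    refine (ae_restrict_iff' measurableSet_Ioc).2 (Eventually.of_forall fun t ht => ?_)
    have ht0 := ht.1.le
    rw [Real.norm_of_nonneg (hgpos t ht0).le]
    have h1 := (hlam_range t ht0).2
    have h2 := (hγ_range t ht0).2.le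
    have h3 := heps_mono 0 t le_rfl ht0
    have h4 := (heps_pos t ht0).le
    have h5 := (hγ_range t ht0).1.le
    simp only [hg]
    gcongr
  have hgt : Tendsto (fun b => ∫ t in (0:ℝ)..b, g t) atTop atTop := by
    refine aux_int_top (fun t ht => (hgpos t ht).le) hgi (fun t ht => ?_) hiii
    have h1 := hgpos t ht
    have h2 : 0 < γ t * eps t := mul_pos (hγ_range t ht).1 (heps_pos t ht)
    have h3 : lam t * γ t * eps t * (2 - γ t * eps t) = 2 * g t - g t * (γ t * eps t) := by
      simp only [hg]; ring
    rw [h3]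
    have := mul_pos h1 h2
    linarith
  have huac : ∀ b, 0 ≤ b → AbsolutelyContinuousOnInterval u 0 b := by
    intro b hb
    set k : ℝ → ℝ := fun t => ‖f t‖ + |epsd t| * (M / eps b) with hk
    have hki : ∀ c, IntervalIntegrable k volume 0 c := fun c =>
      (hfi' c).norm.add ((hepsd_int c).abs.mul_const _)
    have hKn : 0 ≤ M / eps b := div_nonneg (norm_nonneg _) (heps_pos b hb).le
    have hkey : ∀ s t, 0 ≤ s → s ≤ t → t ≤ b →
        dist (u s) (u t) ≤ dist (∫ v in (0:ℝ)..s, k v) (∫ v in (0:ℝ)..t, k v) := by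
      intro s t hs hst htb
      have ht := hs.trans hst
      have h1 : ‖x t - x s‖ ≤ ∫ v in s..t, ‖f v‖ := by
        rw [hxe' t ht, hxe' s hs, add_sub_add_left_eq_sub,
          intervalIntegral.integral_interval_sub_left (hfi' t) (hfi' s)]
        exact intervalIntegral.norm_integral_le_integral_norm hst
      have h2 : eps s - eps t ≤ ∫ v in s..t, |epsd v| := by
        have e : eps s - eps t = -∫ v in s..t, epsd v := by
          rw [← intervalIntegral.integral_interval_sub_left (hepsd_int t) (hepsd_int s),
            hepsAC t ht, hepsAC s hs]; ring
        rw [e]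
        exact (neg_le_abs _).trans (intervalIntegral.abs_integral_le_integral_abs hst)
      have h3 : ‖y t - y s‖ ≤ (∫ v in s..t, |epsd v|) * (M / eps b) := by
        refine (hyL s t hs hst).trans ?_
        have hm := heps_mono t b ht htb
        have hm2 := heps_mono s t hs hst
        have : (eps s - eps t) / eps t * M = (eps s - eps t) * (M / eps t) := by ring
        rw [this]
        refine mul_le_mul h2 ?_ (div_nonneg (norm_nonneg _) (heps_pos t ht).le)
          (le_trans (by linarith) h2)
        exact div_le_div_of_nonneg_left (norm_nonneg _) (heps_pos b hb) hm
      have hst_f : IntervalIntegrable f volume s t := (hfi' s).symm.trans (hfi' t)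
      have hst_e : IntervalIntegrable epsd volume s t := (hepsd_int s).symm.trans (hepsd_int t)
      have h4 : ∫ v in s..t, k v = (∫ v in s..t, ‖f v‖) + (∫ v in s..t, |epsd v|) * (M / eps b) := by
        rw [← intervalIntegral.integral_mul_const]
        exact intervalIntegral.integral_add hst_f.norm (hst_e.abs.mul_const _)
      rw [dist_comm, dist_comm (∫ v in (0:ℝ)..s, k v), Real.dist_eq, Real.dist_eq,
        intervalIntegral.integral_interval_sub_left (hki t) (hki s)]
      refine le_trans ?_ (le_abs_self _)
      rw [h4]
      refine (abs_norm_sub_norm_le _ _).trans ?_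
      have e : x t - y t - (x s - y s) = (x t - x s) - (y t - y s) := by abel
      rw [e]
      exact (norm_sub_le _ _).trans (add_le_add h1 h3)
    refine aux_ac_of_dist_le
      ((hki b).absolutelyContinuousOnInterval_intervalIntegral (c := 0) (by simp)) ?_
    intro s hs t ht
    rw [uIcc_of_le hb] at hs ht
    rcases le_total s t with hst | hst
    · exact hkey s t hs.1 hst ht.2
    · rw [dist_comm, dist_comm (∫ v in (0:ℝ)..s, k v)]
      exact hkey t s ht.1 hst hs.2
  have hu_lim : Tendsto u atTop (𝓝 0) := by
    refine aux_gronwall (fun t _ => norm_nonneg _) (fun t ht => (hgpos t ht).le) hgi hgt huac ?_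
    intro δ hδ
    have hMp : 0 < M + 1 := by positivity
    obtain ⟨N, hN⟩ := Metric.tendsto_atTop'.1 hii (δ / (M + 1)) (by positivity)
    refine ⟨max N 0, le_max_right _ _, fun b => ?_⟩
    filter_upwards [(hfi' (b + 1)).ae_hasDerivAt_integral,
      (hepsd_int (b + 1)).ae_hasDerivAt_integral] with t h1 h2 ht hdu
    have ht0 : 0 < t := (le_max_right _ _).trans_lt ht.1
    have hNt : N < t := (le_max_left _ _).trans_lt ht.1
    have htm : t ∈ uIcc 0 (b + 1) := by
      have := ht.2
      rw [uIcc_of_le (by linarith)]; exact ⟨ht0.le, by linarith⟩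
    have hxd : HasDerivAt x (f t) t := by
      refine ((h1 htm 0 (by simp)).const_add x₀).congr_of_eventuallyEq ?_
      filter_upwards [Ioi_mem_nhds ht0] with s hs using hxe' s (le_of_lt hs)
    have hed : HasDerivAt eps (epsd t) t := by
      refine ((h2 htm 0 (by simp)).const_add (eps 0)).congr_of_eventuallyEq ?_
      filter_upwards [Ioi_mem_nhds ht0] with s hs using hepsAC s (le_of_lt hs)
    have hT := (aux_contr hβ hA.1 hB (heps_pos t ht0.le) (hγ_range t ht0.le).1 (hγle t ht0.le)
      (hJ t ht0.le)).2 (x t) (y t)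
    rw [(hy t ht0.le).1] at hT
    have hmain := aux_deriv_le (hlam_range t ht0.le).1 (norm_nonneg p) (heps_pos t ht0.le) hxd hed
      hT (fun s hs => hyL t s ht0.le hs.le) hdu
    have hr := hN t hNt
    have hep := heps_pos t ht0.le
    have hgp := hgpos t ht0.le
    have e1 : eps t ^ 2 * lam t * γ t = eps t * g t := by simp only [hg]; ring
    rw [Real.dist_eq, sub_zero, e1, abs_div, abs_of_pos (mul_pos hep hgp),
      div_lt_div_iff₀ (mul_pos hep hgp) hMp] at hr
    have h3 : |epsd t| / eps t * M ≤ δ * g t := by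
      rw [div_mul_eq_mul_div, div_le_iff₀ hep]
      have := abs_nonneg (epsd t)
      linarith
    have h4 : deriv u t ≤ -g t * u t + |epsd t| / eps t * M := hmain
    linarith
  have hxy : Tendsto (fun t => x t - y t) atTop (𝓝 0) := tendsto_zero_iff_norm_tendsto_zero.2 hu_lim
  have := hxy.add hpl
  simpa using this
end

section
/- Let H be a real Hilbert space, A : H → Set H monotone, B : H → H monotone and (1/β)-Lipschitz continuous with β > 0, and let ε > 0 and γ > 0 satisfy γ < β/(εβ + 1). Let J : H → H satisfy (1/γ)(x − J x) ∈ A(J x) for all x ∈ H, set B_ε := B + ε·Id and C_ε := Id − γ·B_ε, and define V : H → H by V(x) := C_ε( J( C_ε x ) ) − C_ε x. Then for all x, y ∈ H it holds ‖V(x) − V(y)‖ ≤ √6 · ‖x − y‖. -/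
open Filter MeasureTheory Set Topology
open scoped RealInnerProductSpace

variable {H : Type*} [NormedAddCommGroup H] [InnerProductSpace ℝ H] [CompleteSpace H]

/-- The forward-backward-forward vector field `V(x) = C_ε(J(C_ε x)) − C_ε x`,
where `C_ε = Id − γ·(B + ε·Id)`. -/
def Veg (B J : H → H) (ε γ : ℝ) (x : H) : H :=
  (fun w => w - γ • (B w + ε • w)) (J ((fun w => w - γ • (B w + ε • w)) x)) -
    (fun w => w - γ • (B w + ε • w)) x

theorem fbf_aux (d b p e : H) (hb : ‖b‖ ≤ ‖d‖) (hbd : 0 ≤ ⟪b, d⟫) (he : ‖e‖ ≤ ‖p‖)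
    (hep : 0 ≤ ⟪e, p⟫) (hp : 0 ≤ ⟪(d - b) - p, p⟫) :
    ‖(p - e) - (d - b)‖ ≤ Real.sqrt 6 * ‖d‖ := by
  obtain ⟨c, hc⟩ : ∃ c, c = d - b := ⟨_, rfl⟩
  rw [← hc] at hp ⊢
  have hb2 : ‖b‖ ^ 2 ≤ ‖d‖ ^ 2 := by gcongr
  have he2 : ‖e‖ ^ 2 ≤ ‖p‖ ^ 2 := by gcongr
  have h1 : ‖c‖ ^ 2 = ‖d‖ ^ 2 - 2 * ⟪b, d⟫ + ‖b‖ ^ 2 := by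
    rw [hc, norm_sub_sq_real, real_inner_comm]
  have h2 : ‖c - p‖ ^ 2 = ‖c‖ ^ 2 - 2 * ⟪c, p⟫ + ‖p‖ ^ 2 := norm_sub_sq_real _ _
  have h3 : ‖e - c‖ ^ 2 = ‖e‖ ^ 2 - 2 * ⟪e, c⟫ + ‖c‖ ^ 2 := norm_sub_sq_real _ _
  have h4 : ‖(p - e) - c‖ ^ 2
      = ‖p‖ ^ 2 - 2 * ⟪e, p⟫ + ‖e‖ ^ 2 - 2 * (⟪c, p⟫ - ⟪e, c⟫) + ‖c‖ ^ 2 := by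
    rw [norm_sub_sq_real, norm_sub_sq_real, inner_sub_left, real_inner_comm e p,
      real_inner_comm c p]
  rw [inner_sub_left, real_inner_self_eq_norm_sq] at hp
  have h5 := sq_nonneg ‖c - p‖
  have h6 := sq_nonneg ‖e - c‖
  refine (sq_le_sq₀ (norm_nonneg _) (by positivity)).1 ?_
  rw [mul_pow, Real.sq_sqrt (by norm_num)]
  linarith

theorem stmt13 (A : H → Set H) (B : H → H) (β : ℝ) (hβ : 0 < β)
    (hA : MonotoneSV A)
    (hBmono : ∀ x y : H, 0 ≤ ⟪B x - B y, x - y⟫)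
    (hBlip : ∀ x y : H, ‖B x - B y‖ ≤ (1 / β) * ‖x - y‖)
    (ε γ : ℝ) (hε : 0 < ε) (hγ : 0 < γ) (hγβ : γ < β / (ε * β + 1))
    (J : H → H) (hJ : ∀ w : H, (1 / γ) • (w - J w) ∈ A (J w)) :
    ∀ x y : H, ‖Veg B J ε γ x - Veg B J ε γ y‖ ≤ Real.sqrt 6 * ‖x - y‖ := by
  have hcoef : γ * (1 / β + ε) ≤ 1 := by
    rw [lt_div_iff₀ (by positivity)] at hγβ
    have : γ * (1 / β + ε) = γ * (ε * β + 1) / β := by field_simp; ring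
    rw [this, div_le_one hβ]
    exact hγβ.le
  have key : ∀ x y : H, (γ • (B x + ε • x) - γ • (B y + ε • y))
      = γ • ((B x - B y) + ε • (x - y)) := by
    intro x y
    module
  have hn : ∀ x y : H, ‖γ • (B x + ε • x) - γ • (B y + ε • y)‖ ≤ ‖x - y‖ := by
    intro x y
    rw [key, norm_smul, Real.norm_of_nonneg hγ.le]
    have h1 : ‖(B x - B y) + ε • (x - y)‖ ≤ (1 / β + ε) * ‖x - y‖ := by
      refine (norm_add_le _ _).trans ?_
      rw [norm_smul, Real.norm_of_nonneg hε.le]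
      linarith [hBlip x y]
    calc _ ≤ γ * ((1 / β + ε) * ‖x - y‖) := by gcongr
      _ = (γ * (1 / β + ε)) * ‖x - y‖ := by ring
      _ ≤ 1 * ‖x - y‖ := by gcongr
      _ = _ := one_mul _
  have hi : ∀ x y : H, 0 ≤ ⟪γ • (B x + ε • x) - γ • (B y + ε • y), x - y⟫ := by
    intro x y
    rw [key, real_inner_smul_left, inner_add_left, real_inner_smul_left,
      real_inner_self_eq_norm_sq]
    have := hBmono x y
    positivity
  have hJm : ∀ u v : H, 0 ≤ ⟪(u - v) - (J u - J v), J u - J v⟫ := by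
    intro u v
    have h := hA _ _ _ _ (hJ u) (hJ v)
    rw [← smul_sub, real_inner_smul_left] at h
    have h2 := nonneg_of_mul_nonneg_right h (by positivity)
    rwa [sub_sub_sub_comm] at h2
  intro x y
  obtain ⟨u, hu⟩ : ∃ u, u = x - γ • (B x + ε • x) := ⟨_, rfl⟩
  obtain ⟨v, hv⟩ : ∃ v, v = y - γ • (B y + ε • y) := ⟨_, rfl⟩
  have huv : u - v = (x - y) - (γ • (B x + ε • x) - γ • (B y + ε • y)) := by
    rw [hu, hv]; abel
  have hm := hJm u v
  rw [huv] at hm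
  have := fbf_aux _ _ _ _ (hn x y) (hi x y) (hn (J u) (J v)) (hi (J u) (J v)) hm
  rw [← huv] at this
  convert this using 2
  simp only [Veg, ← hu, ← hv]
  abel
end
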